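/- arXiv:math/0601604 — 2 statements merged into one kernel-verified Lean document; each statement's English description precedes it below -/
import Mathlib

section
/- Let ξ be a real number and ε > 0. Suppose there exists a sequence (p_n/q_n)_{n≥1} of distinct rational numbers with q_n ≥ 2, |ξ − p_n/q_n| < q_n^{−(2+ε)} for all n, and limsup_n log(q_{n+1})/log(q_n) < ∞. Then ξ is not a U-number, i.e. w_m(ξ) < ∞ for every m ≥ 1. -/
open Polynomial

/-- The height of an integer polynomial: maximum modulus of its coefficients. -/
def polyHeight (P : Polynomial ℤ) : ℕ := P.support.sup fun i => (P.coeff i).natAbs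

/-- `w_m(ξ) < ∞`: there is some `ω` such that only finitely many integer polynomials of
degree at most `m` satisfy `0 < |P(ξ)| ≤ H(P)^{-ω}`. -/
def WFinite (ξ : ℝ) (m : ℕ) : Prop :=
  ∃ ω : ℝ, {P : Polynomial ℤ | P.natDegree ≤ m ∧ 0 < |aeval ξ P| ∧
    |aeval ξ P| ≤ (polyHeight P : ℝ) ^ (-ω)}.Finite

namespace Bak

/-- Real polynomials in `r` variables. -/
abbrev A (r : ℕ) := MvPolynomial (Fin r) ℝ

/-- translation `P(X) ↦ P(X + s)` -/
noncomputable def shift {r : ℕ} (s : Fin r → ℝ) : A r →ₐ[ℝ] A r :=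
  MvPolynomial.aeval (fun i => MvPolynomial.X i + MvPolynomial.C (s i))

/-- weight of a monomial -/
noncomputable def wt {r : ℕ} (d : Fin r → ℕ) (e : Fin r →₀ ℕ) : ℝ := ∑ i, (e i : ℝ) / (d i : ℝ)

/-- the index of `P` at `s` is at least `θ` -/
def IdxGE {r : ℕ} (d : Fin r → ℕ) (s : Fin r → ℝ) (θ : ℝ) (P : A r) : Prop :=
  ∀ e, (shift s P).coeff e ≠ 0 → θ ≤ wt d e

/-- polynomials with partial degrees bounded by `b` -/
def Box {r : ℕ} (b : Fin r → ℕ) : Submodule ℝ (A r) where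
  carrier := {f | ∀ e, f.coeff e ≠ 0 → ∀ i, e i ≤ b i}
  add_mem' := by
    intro f g hf hg e he i
    rw [MvPolynomial.coeff_add] at he
    by_cases h : f.coeff e = 0
    · exact hg e (by rw [h, zero_add] at he; exact he) i
    · exact hf e h i
  zero_mem' := by intro e he; simp at he
  smul_mem' := by
    intro c f hf e he i
    rw [MvPolynomial.coeff_smul] at he
    exact hf e (fun h => he (by simp [h])) i

lemma mem_Box {r : ℕ} {b : Fin r → ℕ} {f : A r} :
    f ∈ Box b ↔ ∀ e, f.coeff e ≠ 0 → ∀ i, e i ≤ b i := Iff.rfl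

lemma exists_of_coeff_mul {r : ℕ} {f g : A r} {e : Fin r →₀ ℕ} (h : (f * g).coeff e ≠ 0) :
    ∃ a b, a + b = e ∧ f.coeff a ≠ 0 ∧ g.coeff b ≠ 0 := by
  classical
  rw [MvPolynomial.coeff_mul] at h
  obtain ⟨x, hx, hne⟩ := Finset.exists_ne_zero_of_sum_ne_zero h
  exact ⟨x.1, x.2, Finset.HasAntidiagonal.mem_antidiagonal.1 hx, left_ne_zero_of_mul hne, right_ne_zero_of_mul hne⟩

lemma Box_mul {r : ℕ} {b c : Fin r → ℕ} {f g : A r} (hf : f ∈ Box b) (hg : g ∈ Box c) :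
    f * g ∈ Box (b + c) := by
  intro e he i
  obtain ⟨x, y, rfl, hx, hy⟩ := exists_of_coeff_mul he
  have := hf x hx i
  have := hg y hy i
  simp only [Finsupp.add_apply, Pi.add_apply]; omega

lemma Box_one {r : ℕ} : (1 : A r) ∈ Box (0 : Fin r → ℕ) := by
  classical
  intro e he i
  rw [MvPolynomial.coeff_one] at he
  have : e = 0 := by by_contra h; exact he (if_neg (fun h' => h h'.symm))
  simp [this]

lemma Box_prod {r : ℕ} {ι : Type*} (S : Finset ι) {b : Fin r → ℕ} {f : ι → A r}
    (hf : ∀ i ∈ S, f i ∈ Box b) : ∏ i ∈ S, f i ∈ Box (S.card • b) := by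
  classical
  induction S using Finset.induction_on with
  | empty => simpa using Box_one
  | insert a S ha ih =>
    rw [Finset.prod_insert ha, Finset.card_insert_of_notMem ha, succ_nsmul']
    exact Box_mul (hf a (by simp)) (ih fun i hi => hf i (by simp [hi]))

lemma Box_det {r k : ℕ} {b : Fin r → ℕ} (N : Matrix (Fin k) (Fin k) (A r))
    (h : ∀ i j, N i j ∈ Box b) : N.det ∈ Box (k • b) := by
  rw [Matrix.det_apply]
  refine Submodule.sum_mem _ fun σ _ => ?_
  have := Box_prod Finset.univ (b := b) (f := fun i => N (σ i) i) (fun i _ => h _ _)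
  rw [Finset.card_univ, Fintype.card_fin] at this
  rcases Int.units_eq_one_or (Equiv.Perm.sign σ) with h1 | h1 <;> rw [h1]
  · simpa using this
  · simpa using this

lemma wt_add {r : ℕ} (d : Fin r → ℕ) (x y : Fin r →₀ ℕ) : wt d (x + y) = wt d x + wt d y := by
  simp [wt, add_div, Finset.sum_add_distrib]

lemma wt_nonneg {r : ℕ} (d : Fin r → ℕ) (x : Fin r →₀ ℕ) : 0 ≤ wt d x := by
  unfold wt; positivity

lemma IdxGE.mono {r : ℕ} {d : Fin r → ℕ} {s : Fin r → ℝ} {θ θ' : ℝ} {P : A r}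
    (h : IdxGE d s θ P) (h' : θ' ≤ θ) : IdxGE d s θ' P := fun e he => h'.trans (h e he)

lemma IdxGE.zero {r : ℕ} {d : Fin r → ℕ} {s : Fin r → ℝ} (P : A r) : IdxGE d s 0 P :=
  fun e _ => wt_nonneg d e

lemma IdxGE.add {r : ℕ} {d : Fin r → ℕ} {s : Fin r → ℝ} {θ : ℝ} {P Q : A r}
    (h : IdxGE d s θ P) (h' : IdxGE d s θ Q) : IdxGE d s θ (P + Q) := by
  intro e he
  rw [map_add, MvPolynomial.coeff_add] at he
  by_cases h0 : (shift s P).coeff e = 0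
  · exact h' e (by rw [h0, zero_add] at he; exact he)
  · exact h e h0

lemma IdxGE.smul {r : ℕ} {d : Fin r → ℕ} {s : Fin r → ℝ} {θ : ℝ} {P : A r}
    (h : IdxGE d s θ P) (c : ℝ) : IdxGE d s θ (c • P) := by
  intro e he
  rw [map_smul, MvPolynomial.coeff_smul] at he
  exact h e (fun h0 => he (by simp [h0]))

lemma IdxGE.sum {r : ℕ} {d : Fin r → ℕ} {s : Fin r → ℝ} {θ : ℝ} {ι : Type*} (S : Finset ι)
    {P : ι → A r} (h : ∀ i ∈ S, IdxGE d s θ (P i)) : IdxGE d s θ (∑ i ∈ S, P i) := by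
  classical
  induction S using Finset.induction_on with
  | empty => intro e he; simp at he
  | insert a S ha ih =>
    rw [Finset.sum_insert ha]
    exact (h a (by simp)).add (ih fun i hi => h i (by simp [hi]))

lemma IdxGE.mul {r : ℕ} {d : Fin r → ℕ} {s : Fin r → ℝ} {θ θ' : ℝ} {P Q : A r}
    (h : IdxGE d s θ P) (h' : IdxGE d s θ' Q) : IdxGE d s (θ + θ') (P * Q) := by
  intro e he
  rw [map_mul] at he
  obtain ⟨x, y, rfl, hx, hy⟩ := exists_of_coeff_mul he
  rw [wt_add]
  exact add_le_add (h x hx) (h' y hy)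

lemma IdxGE.prod {r : ℕ} {d : Fin r → ℕ} {s : Fin r → ℝ} {ι : Type*} (S : Finset ι) {θ : ι → ℝ}
    {P : ι → A r} (h : ∀ i ∈ S, IdxGE d s (θ i) (P i)) :
    IdxGE d s (∑ i ∈ S, θ i) (∏ i ∈ S, P i) := by
  classical
  induction S using Finset.induction_on with
  | empty => simpa using IdxGE.zero _
  | insert a S ha ih =>
    rw [Finset.prod_insert ha, Finset.sum_insert ha]
    exact (h a (by simp)).mul (ih fun i hi => h i (by simp [hi]))

lemma IdxGE.det {r k : ℕ} {d : Fin r → ℕ} {s : Fin r → ℝ} {θ : Fin k → ℝ}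
    (N : Matrix (Fin k) (Fin k) (A r)) (h : ∀ i j, IdxGE d s (θ j) (N i j)) :
    IdxGE d s (∑ j, θ j) N.det := by
  rw [Matrix.det_apply]
  refine IdxGE.sum _ fun σ _ => ?_
  have := IdxGE.prod (d := d) (s := s) Finset.univ (θ := θ) (P := fun i => N (σ i) i)
    (fun i _ => h _ _)
  rcases Int.units_eq_one_or (Equiv.Perm.sign σ) with h1 | h1 <;> rw [h1]
  · simpa using this
  · simpa using this.smul (-1)

/-- The operator `x_c ∂_c - b`. -/
noncomputable def euler {r : ℕ} (c : Fin r) (b : ℝ) : A r →ₗ[ℝ] A r :=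
  (LinearMap.mulLeft ℝ (MvPolynomial.X c)) ∘ₗ (MvPolynomial.pderiv c).toLinearMap
    - b • LinearMap.id

lemma euler_apply {r : ℕ} (c : Fin r) (b : ℝ) (f : A r) :
    euler c b f = MvPolynomial.X c * MvPolynomial.pderiv c f - b • f := by
  simp [euler]

lemma coeff_euler {r : ℕ} (c : Fin r) (b : ℝ) (f : A r) (e : Fin r →₀ ℕ) :
    (euler c b f).coeff e = ((e c : ℝ) - b) * f.coeff e := by
  classical
  rw [euler_apply, MvPolynomial.coeff_sub, MvPolynomial.coeff_smul, sub_mul, smul_eq_mul]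
  congr 1
  induction f using MvPolynomial.induction_on' with
  | monomial u a =>
    rw [MvPolynomial.X_mul_pderiv_monomial, MvPolynomial.coeff_smul, MvPolynomial.coeff_monomial]
    split_ifs with h
    · simp [h]
    · simp
  | add p q hp hq => simp only [map_add, mul_add, MvPolynomial.coeff_add, hp, hq]

lemma shift_pderiv {r : ℕ} (s : Fin r → ℝ) (c : Fin r) (f : A r) :
    shift s (MvPolynomial.pderiv c f) = MvPolynomial.pderiv c (shift s f) := by
  classical
  induction f using MvPolynomial.induction_on with
  | C a => simp [shift]
  | add p q hp hq => simp [hp, hq]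
  | mul_X p i hp =>
    simp only [MvPolynomial.pderiv_mul, map_add, map_mul, hp]
    congr 2
    simp [shift, MvPolynomial.pderiv_X, Pi.single_apply]

lemma IdxGE.pderiv {r : ℕ} {d : Fin r → ℕ} {s : Fin r → ℝ} {θ : ℝ} {P : A r}
    (h : IdxGE d s θ P) (c : Fin r) :
    IdxGE d s (θ - 1 / (d c : ℝ)) (MvPolynomial.pderiv c P) := by
  classical
  intro e he
  rw [shift_pderiv, MvPolynomial.coeff_pderiv] at he
  have h1 := h _ (left_ne_zero_of_mul he)
  rw [wt_add] at h1
  have : wt d (Finsupp.single c 1) = 1 / (d c : ℝ) := by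
    unfold wt
    rw [Finset.sum_eq_single c]
    · simp
    · intro b _ hb; simp [hb.symm]
    · simp
  linarith

lemma IdxGE.euler {r : ℕ} {d : Fin r → ℕ} {s : Fin r → ℝ} {θ : ℝ} {P : A r}
    (h : IdxGE d s θ P) (c : Fin r) (b : ℝ) :
    IdxGE d s (θ - 1 / (d c : ℝ)) (euler c b P) := by
  rw [euler_apply, sub_eq_add_neg (_ * _), ← neg_smul]
  refine IdxGE.add ?_ ((h.mono ?_).smul _)
  · have := (IdxGE.zero (d := d) (s := s) (MvPolynomial.X c)).mul (h.pderiv c)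
    rwa [zero_add] at this
  · have : 0 ≤ 1 / (d c : ℝ) := by positivity
    linarith

/-- compositions of Euler operators -/
noncomputable def opL {r : ℕ} (l : List (Fin r × ℝ)) : A r →ₗ[ℝ] A r :=
  l.foldr (fun x L => (euler x.1 x.2) ∘ₗ L) LinearMap.id

lemma opL_nil {r : ℕ} (f : A r) : opL [] f = f := rfl
lemma opL_cons {r : ℕ} (x : Fin r × ℝ) (l : List (Fin r × ℝ)) (f : A r) :
    opL (x :: l) f = euler x.1 x.2 (opL l f) := rfl

lemma coeff_opL {r : ℕ} (l : List (Fin r × ℝ)) (f : A r) (e : Fin r →₀ ℕ) :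
    (opL l f).coeff e = (l.map (fun x => (e x.1 : ℝ) - x.2)).prod * f.coeff e := by
  induction l with
  | nil => simp [opL_nil]
  | cons x l ih => rw [opL_cons, coeff_euler, ih]; simp [mul_assoc]

lemma opL_Box {r : ℕ} (l : List (Fin r × ℝ)) {b : Fin r → ℕ} {f : A r} (hf : f ∈ Box b) :
    opL l f ∈ Box b := by
  intro e he
  rw [coeff_opL] at he
  exact hf e (right_ne_zero_of_mul he)

lemma IdxGE.opL {r : ℕ} {d : Fin r → ℕ} {s : Fin r → ℝ} {θ w : ℝ} {P : A r}
    (h : IdxGE d s θ P) (l : List (Fin r × ℝ)) (hw : ∀ x ∈ l, 1 / (d x.1 : ℝ) ≤ w) :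
    IdxGE d s (θ - l.length * w) (opL l P) := by
  induction l with
  | nil => simpa [opL_nil] using h
  | cons x l ih =>
    rw [opL_cons]
    refine ((ih fun y hy => hw y (by simp [hy])).euler x.1 x.2).mono ?_
    have := hw x (by simp)
    simp only [List.length_cons]; push_cast; linarith

lemma euler_mul {r : ℕ} (c : Fin r) (b : ℝ) (f g : A r)
    (hg : MvPolynomial.pderiv c g = 0) : euler c b (f * g) = euler c b f * g := by
  rw [euler_apply, euler_apply, MvPolynomial.pderiv_mul, hg, sub_mul, smul_mul_assoc]
  ring

lemma pderiv_eq_zero_of_Box {r : ℕ} {b : Fin r → ℕ} {c : Fin r} (hc : b c = 0) {f : A r}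
    (hf : f ∈ Box b) : MvPolynomial.pderiv c f = 0 := by
  ext e
  rw [MvPolynomial.coeff_pderiv, MvPolynomial.coeff_zero]
  by_contra h
  have := hf _ (left_ne_zero_of_mul h) c
  simp [hc] at this

lemma opL_mul {r : ℕ} (l : List (Fin r × ℝ)) {b : Fin r → ℕ} (f g : A r) (hg : g ∈ Box b)
    (hl : ∀ x ∈ l, b x.1 = 0) : opL l (f * g) = opL l f * g := by
  induction l with
  | nil => rfl
  | cons x l ih =>
    rw [opL_cons, opL_cons, ih fun y hy => hl y (by simp [hy]), euler_mul]
    exact pderiv_eq_zero_of_Box (hl x (by simp)) hg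

/-! ### Generalised Wronskians -/

lemma exists_distinct_degrees {r k : ℕ} (f : Fin k → A r) (hf : LinearIndependent ℝ f) :
    ∃ g : Fin k → A r, (∀ i, g i ∈ Submodule.span ℝ (Set.range f)) ∧ (∀ i, g i ≠ 0) ∧
      Function.Injective (fun i => (MonomialOrder.lex (σ := Fin r)).degree (g i)) := by
  classical
  set m := MonomialOrder.lex (σ := Fin r)
  set V := Submodule.span ℝ (Set.range f)
  set L : Set (Fin r →₀ ℕ) := {μ | ∃ g ∈ V, g ≠ 0 ∧ m.degree g = μ}
  have key : ∃ T : Finset (Fin r →₀ ℕ), (T : Set _) ⊆ L ∧ T.card = k := by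
    by_cases hL : L.Finite
    · have hcard : k ≤ hL.toFinset.card := by
        have hV : Module.finrank ℝ V = k := by
          rw [finrank_span_eq_card hf, Fintype.card_fin]
        let φ : V →ₗ[ℝ] (hL.toFinset → ℝ) :=
          LinearMap.pi (fun μ => (MvPolynomial.lcoeff ℝ (μ : Fin r →₀ ℕ)) ∘ₗ V.subtype)
        have hφ : Function.Injective φ := by
          rw [← LinearMap.ker_eq_bot, LinearMap.ker_eq_bot']
          intro g hg
          by_contra hne
          have hne' : (g : A r) ≠ 0 := fun h => hne (Subtype.ext h)
          have := congrFun hg ⟨m.degree (g : A r), by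
            rw [Set.Finite.mem_toFinset]; exact ⟨g, g.2, hne', rfl⟩⟩
          simp only [φ, LinearMap.pi_apply, LinearMap.comp_apply, Submodule.subtype_apply,
            Pi.zero_apply, MvPolynomial.lcoeff_apply] at this
          exact (m.coeff_degree_ne_zero_iff.2 hne') this
        have := LinearMap.finrank_le_finrank_of_injective hφ
        rw [hV, Module.finrank_fintype_fun_eq_card, Fintype.card_coe] at this
        exact this
      obtain ⟨T, hT, hc⟩ := Finset.exists_subset_card_eq hcard
      exact ⟨T, fun x hx => (Set.Finite.mem_toFinset hL).1 (hT hx), hc⟩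
    · exact Set.Infinite.exists_subset_card_eq hL k
  obtain ⟨T, hT, hc⟩ := key
  let eq := T.equivFinOfCardEq hc
  have : ∀ i : Fin k, ∃ g ∈ V, g ≠ 0 ∧ m.degree g = (eq.symm i : Fin r →₀ ℕ) :=
    fun i => hT (eq.symm i).2
  choose g h1 h2 h3 using this
  refine ⟨g, h1, h2, fun i j hij => ?_⟩
  simp only [h3] at hij
  exact eq.symm.injective (Subtype.ext hij)

lemma coeff_prod_le {r : ℕ} {ι : Type*} (m : MonomialOrder (Fin r)) (S : Finset ι) (P : ι → A r)
    (μ : ι → Fin r →₀ ℕ) (h : ∀ i ∈ S, m.toSyn (m.degree (P i)) ≤ m.toSyn (μ i)) :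
    m.toSyn (m.degree (∏ i ∈ S, P i)) ≤ m.toSyn (∑ i ∈ S, μ i) ∧
    (∏ i ∈ S, P i).coeff (∑ i ∈ S, μ i) = ∏ i ∈ S, (P i).coeff (μ i) := by
  classical
  induction S using Finset.induction_on with
  | empty => simp
  | insert a S ha ih =>
    have ih := ih fun i hi => h i (by simp [hi])
    have ha' := h a (by simp)
    rw [Finset.prod_insert ha, Finset.sum_insert ha, Finset.prod_insert ha]
    constructor
    · refine m.degree_mul_le.trans ?_
      rw [map_add, map_add]
      exact add_le_add ha' ih.1
    · rw [m.coeff_mul_of_add_of_degree_le ha' ih.1, ih.2]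

lemma wronskian {r k : ℕ} {b : Fin r → ℕ} (f : Fin k → A r) (hf : LinearIndependent ℝ f)
    (hb : ∀ i, f i ∈ Box b) :
    ∃ ls : Fin k → List (Fin r × ℝ), (∀ i, (ls i).length = i) ∧
      (∀ i, ∀ x ∈ ls i, b x.1 ≠ 0) ∧
      (Matrix.of fun i j => opL (ls i) (f j)).det ≠ 0 := by
  classical
  obtain ⟨g, hgV, hg0, hinj⟩ := exists_distinct_degrees f hf
  set m := MonomialOrder.lex (σ := Fin r)
  set μ : Fin k → Fin r →₀ ℕ := fun i => m.degree (g i) with hμ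
  have hVB : Submodule.span ℝ (Set.range f) ≤ Box b := by
    rw [Submodule.span_le]; rintro _ ⟨i, rfl⟩; exact hb i
  have hlc : ∀ i, (g i).coeff (μ i) ≠ 0 := fun i => m.coeff_degree_ne_zero_iff.2 (hg0 i)
  have hμb : ∀ i c, μ i c ≤ b c := fun i c => hVB (hgV i) _ (hlc i) c
  have hsep : ∀ i l : Fin k, i ≠ l → ∃ c, μ i c ≠ μ l c := by
    intro i l hil
    by_contra! h
    exact hil (hinj (Finsupp.ext h))
  have hsep2 : ∀ (i : Fin k) (l : Fin i), ∃ c, μ i c ≠ μ ⟨l, l.2.trans i.2⟩ c := by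
    intro i l
    refine hsep i _ (fun h => ?_)
    have := congrArg Fin.val h
    simp at this
    omega
  choose c hc using hsep2
  let ls : Fin k → List (Fin r × ℝ) := fun i =>
    List.ofFn (fun l : Fin i => (c i l, (μ ⟨l, l.2.trans i.2⟩ (c i l) : ℝ)))
  refine ⟨ls, fun i => by simp [ls], ?_, ?_⟩
  · intro i x hx
    simp only [ls, List.mem_ofFn] at hx
    obtain ⟨l, rfl⟩ := hx
    have h1 := hc i l
    have h2 := hμb i (c i l)
    have h3 := hμb ⟨l, l.2.trans i.2⟩ (c i l)
    simp only
    omega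
  -- the determinant for `g`
  set N : Matrix (Fin k) (Fin k) (A r) := Matrix.of fun i j => opL (ls i) (g j) with hN
  have hdeg : ∀ i j, m.toSyn (m.degree (N i j)) ≤ m.toSyn (μ j) := by
    intro i j
    rw [MonomialOrder.degree_le_iff]
    intro e he
    rw [MvPolynomial.mem_support_iff, hN, Matrix.of_apply, coeff_opL] at he
    exact m.le_degree (MvPolynomial.mem_support_iff.2 (right_ne_zero_of_mul he))
  have hcoef : N.det.coeff (∑ j, μ j) = (Matrix.of fun i j => (N i j).coeff (μ j)).det := by
    rw [Matrix.det_apply, Matrix.det_apply, MvPolynomial.coeff_sum]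
    refine Finset.sum_congr rfl fun σ _ => ?_
    have h := (coeff_prod_le m Finset.univ (fun i => N (σ i) i) μ (fun i _ => hdeg _ _)).2
    rcases Int.units_eq_one_or (Equiv.Perm.sign σ) with h1 | h1 <;> rw [h1] <;> simp [h]
  have hprod : ∀ i j : Fin k, (N i j).coeff (μ j) =
      (∏ l : Fin i, ((μ j (c i l) : ℝ) - μ ⟨l, l.2.trans i.2⟩ (c i l))) * (g j).coeff (μ j) := by
    intro i j
    rw [hN, Matrix.of_apply, coeff_opL]
    simp only [ls, List.map_ofFn, List.prod_ofFn, Function.comp_apply]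
  have hNdet : N.det ≠ 0 := by
    intro h0
    rw [h0, MvPolynomial.coeff_zero] at hcoef
    rw [Matrix.det_of_isUpperTriangular] at hcoef
    · have := Finset.prod_eq_zero_iff.1 hcoef.symm
      obtain ⟨i, -, hi⟩ := this
      rw [Matrix.of_apply, hprod] at hi
      rcases mul_eq_zero.1 hi with h | h
      · obtain ⟨l, -, hl⟩ := Finset.prod_eq_zero_iff.1 h
        exact hc i l (by exact_mod_cast sub_eq_zero.1 hl)
      · exact hlc i h
    · intro i j hij
      simp only [id] at hij
      rw [Matrix.of_apply, hprod, Finset.prod_eq_zero (Finset.mem_univ (⟨j, hij⟩ : Fin i)), zero_mul]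
      simp
  have hspan : ∀ j, ∃ cf : Fin k → ℝ, ∑ l, cf l • f l = g j :=
    fun j => (Submodule.mem_span_range_iff_exists_fun ℝ).1 (hgV j)
  choose cf hcf using hspan
  intro h0
  apply hNdet
  have : N = (Matrix.of fun i j => opL (ls i) (f j)) *
      (Matrix.of fun l j => MvPolynomial.C (cf j l)) := by
    ext1 i j
    rw [Matrix.mul_apply, hN, Matrix.of_apply, ← hcf j, map_sum]
    refine Finset.sum_congr rfl fun l _ => ?_
    rw [map_smul, Matrix.of_apply, Matrix.of_apply, mul_comm, MvPolynomial.smul_eq_C_mul]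
  rw [this, Matrix.det_mul, h0, zero_mul]

end Bak

namespace Bak

lemma decomp {r : ℕ} (A1 A2 : Submodule ℝ (A r)) (P : A r) (n : ℕ)
    (h : ∃ φ ψ : Fin n → A r, (∀ i, φ i ∈ A1) ∧ (∀ i, ψ i ∈ A2) ∧ P = ∑ i, φ i * ψ i) :
    ∃ K ≤ n, ∃ φ ψ : Fin K → A r, (∀ i, φ i ∈ A1) ∧ (∀ i, ψ i ∈ A2) ∧ P = ∑ i, φ i * ψ i ∧
      LinearIndependent ℝ φ ∧ LinearIndependent ℝ ψ := by
  classical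
  induction n using Nat.strong_induction_on with
  | _ n ih =>
  obtain ⟨φ, ψ, h1, h2, h3⟩ := h
  by_cases hφ : LinearIndependent ℝ φ
  · by_cases hψ : LinearIndependent ℝ ψ
    · exact ⟨n, le_rfl, φ, ψ, h1, h2, h3, hφ, hψ⟩
    · obtain ⟨g, hg, l, hl⟩ := Fintype.not_linearIndependent_iff.1 hψ
      obtain ⟨n, rfl⟩ : ∃ n', n = n' + 1 := ⟨n - 1, by have := l.2; omega⟩
      obtain ⟨K, hK, rest⟩ := ih n (by omega) ⟨fun i => φ (l.succAbove i) - (g (l.succAbove i) / g l) • φ l,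
        fun i => ψ (l.succAbove i),
        fun i => Submodule.sub_mem _ (h1 _) (Submodule.smul_mem _ _ (h1 _)), fun i => h2 _, by
          have e : ψ l = - ∑ i, (g (l.succAbove i) / g l) • ψ (l.succAbove i) := by
            rw [Fin.sum_univ_succAbove _ l] at hg
            have : g l • (ψ l + ∑ i, (g (l.succAbove i) / g l) • ψ (l.succAbove i)) = 0 := by
              rw [smul_add, Finset.smul_sum]
              simp only [smul_smul, mul_div_cancel₀ _ hl]
              exact hg
            exact eq_neg_of_add_eq_zero_left ((smul_eq_zero.1 this).resolve_left hl)
          rw [h3, Fin.sum_univ_succAbove _ l, e]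
          simp only [sub_mul, Finset.sum_sub_distrib, mul_neg, Finset.mul_sum, mul_smul_comm, smul_mul_assoc]
          ring⟩
      exact ⟨K, by omega, rest⟩
  · obtain ⟨g, hg, l, hl⟩ := Fintype.not_linearIndependent_iff.1 hφ
    obtain ⟨n, rfl⟩ : ∃ n', n = n' + 1 := ⟨n - 1, by have := l.2; omega⟩
    obtain ⟨K, hK, rest⟩ := ih n (by omega) ⟨fun i => φ (l.succAbove i),
      fun i => ψ (l.succAbove i) - (g (l.succAbove i) / g l) • ψ l,
      fun i => h1 _, fun i => Submodule.sub_mem _ (h2 _) (Submodule.smul_mem _ _ (h2 _)), by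
        have e : φ l = - ∑ i, (g (l.succAbove i) / g l) • φ (l.succAbove i) := by
          rw [Fin.sum_univ_succAbove _ l] at hg
          have : g l • (φ l + ∑ i, (g (l.succAbove i) / g l) • φ (l.succAbove i)) = 0 := by
            rw [smul_add, Finset.smul_sum]
            simp only [smul_smul, mul_div_cancel₀ _ hl]
            exact hg
          exact eq_neg_of_add_eq_zero_left ((smul_eq_zero.1 this).resolve_left hl)
        rw [h3, Fin.sum_univ_succAbove _ l, e]
        simp only [mul_sub, Finset.sum_sub_distrib, neg_mul, Finset.sum_mul, mul_smul_comm, smul_mul_assoc]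
        ring⟩
    exact ⟨K, by omega, rest⟩

/-- initial decomposition with respect to the variable `a` -/
lemma decomp_start {r : ℕ} (a : Fin r) (b : Fin r → ℕ) (hb : b a = 0) (D : ℕ) (P : A r)
    (hP : P ∈ Box (b + Pi.single a D)) :
    ∃ φ ψ : Fin (D + 1) → A r, (∀ i, φ i ∈ Box b) ∧ (∀ i, ψ i ∈ Box (Pi.single a D)) ∧
      P = ∑ i, φ i * ψ i := by
  classical
  refine ⟨fun j => ∑ e ∈ P.support with e a = (j : ℕ), MvPolynomial.monomial (e.erase a) (P.coeff e),
    fun j => MvPolynomial.monomial (Finsupp.single a j) 1, ?_, ?_, ?_⟩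
  · intro j
    refine Submodule.sum_mem _ fun e he => ?_
    intro e' he' i
    rw [MvPolynomial.coeff_monomial] at he'
    have h1 : e.erase a = e' := by by_contra h; simp [h] at he'
    rw [← h1]
    rw [Finset.mem_filter, MvPolynomial.mem_support_iff] at he
    have := hP e he.1 i
    by_cases hi : i = a
    · subst hi; simp
    · rw [Finsupp.erase_ne hi]; simpa [hi] using this
  · intro j e' he' i
    rw [MvPolynomial.coeff_monomial] at he'
    have h1 : Finsupp.single a (j : ℕ) = e' := by by_contra h; simp [h] at he'
    rw [← h1]
    by_cases hi : i = a
    · subst hi; simp; omega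
    · simp [hi]
  · simp only [Finset.sum_mul, MvPolynomial.monomial_mul, mul_one]
    conv_lhs => rw [P.as_sum]
    have : ∀ j : Fin (D + 1), ∑ e ∈ P.support with e a = (j : ℕ),
        MvPolynomial.monomial (e.erase a + Finsupp.single a (j : ℕ)) (P.coeff e) =
        ∑ e ∈ P.support with e a = (j : ℕ), MvPolynomial.monomial e (P.coeff e) := by
      intro j
      refine Finset.sum_congr rfl fun e he => ?_
      rw [Finset.mem_filter] at he
      rw [← he.2, Finsupp.erase_add_single]
    simp only [this]
    have h2 : ∀ e ∈ P.support, e a ∈ Finset.range (D + 1) := by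
      intro e he
      have := hP e (MvPolynomial.mem_support_iff.1 he) a
      simp [hb] at this ⊢; omega
    rw [← Finset.sum_fiberwise_of_maps_to h2, Finset.sum_range]

lemma Box_mono {r : ℕ} {b c : Fin r → ℕ} (h : ∀ i, b i ≤ c i) {f : A r} (hf : f ∈ Box b) :
    f ∈ Box c := fun e he i => (hf e he i).trans (h i)

lemma Box_prod' {r : ℕ} {ι : Type*} (S : Finset ι) {b : ι → Fin r → ℕ} {f : ι → A r}
    (hf : ∀ i ∈ S, f i ∈ Box (b i)) : ∏ i ∈ S, f i ∈ Box (∑ i ∈ S, b i) := by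
  classical
  induction S using Finset.induction_on with
  | empty => simpa using Box_one
  | insert a S ha ih =>
    rw [Finset.prod_insert ha, Finset.sum_insert ha]
    exact Box_mul (hf a (by simp)) (ih fun i hi => hf i (by simp [hi]))

lemma shift_monomial {r : ℕ} (s : Fin r → ℝ) (e : Fin r →₀ ℕ) (c : ℝ) :
    shift s (MvPolynomial.monomial e c) =
      c • ∏ i, (MvPolynomial.X i + MvPolynomial.C (s i)) ^ (e i) := by
  rw [shift, MvPolynomial.aeval_monomial, Finsupp.prod_fintype _ _ (by simp),
    MvPolynomial.smul_eq_C_mul]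
  rfl

lemma shift_Box {r : ℕ} (s : Fin r → ℝ) {b : Fin r → ℕ} {f : A r} (hf : f ∈ Box b) :
    shift s f ∈ Box b := by
  classical
  rw [f.as_sum, map_sum]
  refine Submodule.sum_mem _ fun e he => ?_
  rw [shift_monomial]
  refine Submodule.smul_mem _ _ ?_
  have h1 : ∀ i : Fin r, (MvPolynomial.X i + MvPolynomial.C (s i) : A r) ∈ Box (Pi.single i 1) := by
    intro i
    refine Submodule.add_mem _ ?_ ?_
    · intro e' he' j
      rw [MvPolynomial.coeff_X] at he'
      have h1 : Finsupp.single i 1 = e' := by by_contra h; simp [h] at he'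
      rw [← h1]
      by_cases hj : j = i
      · subst hj; simp
      · simp [hj]
    · intro e' he' j
      rw [MvPolynomial.coeff_C] at he'
      have h1 : 0 = e' := by by_contra h; simp [h] at he'
      simp [← h1]
  have h2 : ∀ i : Fin r, ((MvPolynomial.X i + MvPolynomial.C (s i)) ^ (e i) : A r)
      ∈ Box (e i • Pi.single i 1) := by
    intro i
    have := Box_prod (Finset.range (e i)) (fun _ _ => h1 i)
    simpa using this
  refine Box_mono ?_ (Box_prod' Finset.univ fun i _ => h2 i)
  intro i
  refine le_trans (le_of_eq ?_) (hf e (MvPolynomial.mem_support_iff.1 he) i)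
  simp [Finset.sum_apply, Pi.single_apply]

lemma coeff_mul_disjoint {r : ℕ} {b c : Fin r → ℕ} (hbc : ∀ i, b i = 0 ∨ c i = 0) {f g : A r}
    (hf : f ∈ Box b) (hg : g ∈ Box c) {x y : Fin r →₀ ℕ} (hx : f.coeff x ≠ 0)
    (hy : g.coeff y ≠ 0) : (f * g).coeff (x + y) ≠ 0 := by
  classical
  rw [MvPolynomial.coeff_mul, Finset.sum_eq_single (x, y)]
  · exact mul_ne_zero hx hy
  · rintro ⟨x', y'⟩ h hne
    rw [Finset.HasAntidiagonal.mem_antidiagonal] at h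
    by_contra h0
    apply hne
    have h1 := hf _ (left_ne_zero_of_mul h0)
    have h2 := hg _ (right_ne_zero_of_mul h0)
    have h3 := hf _ hx
    have h4 := hg _ hy
    have hxx : ∀ i, x' i = x i ∧ y' i = y i := by
      intro i
      have a1 := h1 i; have a2 := h2 i; have a3 := h3 i; have a4 := h4 i
      have a5 := DFunLike.congr_fun h i
      simp only [Finsupp.add_apply] at a5
      rcases hbc i with h | h <;> simp only [h] at a1 a2 a3 a4 <;> omega
    exact Prod.ext (Finsupp.ext fun i => (hxx i).1) (Finsupp.ext fun i => (hxx i).2)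
  · intro h
    exact absurd ((Finset.HasAntidiagonal.mem_antidiagonal (n := x + y) (a := (x, y))).2 rfl) h

lemma one_var {r : ℕ} (a : Fin r) (B c : ℕ) (V : A r) (hV0 : V ≠ 0) (hV : V ∈ Box (Pi.single a B))
    (S : Finset ℕ) (s : ℕ → Fin r → ℝ) (hs : Set.InjOn (fun k => s k a) S)
    (hc : B < S.card * c) :
    ∃ k ∈ S, ∃ e, (shift (s k) V).coeff e ≠ 0 ∧ e a < c := by
  classical
  by_contra! hcon
  let ν : A r →ₐ[ℝ] ℝ[X] := MvPolynomial.aeval (fun i => if i = a then Polynomial.X else 0)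
  have hdiv : ∀ k ∈ S, (Polynomial.X - Polynomial.C (s k a)) ^ c ∣ ν V := by
    intro k hk
    let θ : A r →ₐ[ℝ] ℝ[X] := MvPolynomial.aeval
      (fun i => if i = a then Polynomial.X - Polynomial.C (s k a) else - Polynomial.C (s k i))
    have hcomp : θ (shift (s k) V) = ν V := by
      have : θ.comp (shift (s k)) = ν := by
        apply MvPolynomial.algHom_ext
        intro i
        simp only [θ, ν, shift, AlgHom.comp_apply, MvPolynomial.aeval_X, map_add]
        rw [show (MvPolynomial.C (s k i) : A r) = algebraMap ℝ _ (s k i) from rfl, AlgHom.commutes]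
        by_cases h : i = a
        · subst h; simp [Polynomial.algebraMap_eq]
        · simp [h, Polynomial.algebraMap_eq]
      rw [← this]; rfl
    rw [← hcomp, (shift (s k) V).as_sum, map_sum]
    refine Finset.dvd_sum fun e he => ?_
    have hce := hcon k hk e (MvPolynomial.mem_support_iff.1 he)
    rw [MvPolynomial.aeval_monomial, Finsupp.prod_fintype _ _ (by simp)]
    refine Dvd.dvd.mul_left ?_ _
    refine dvd_trans ?_ (Finset.dvd_prod_of_mem _ (Finset.mem_univ a))
    simp only [if_true]
    exact pow_dvd_pow _ hce
  have hprod : ∏ k ∈ S, (Polynomial.X - Polynomial.C (s k a)) ^ c ∣ ν V := by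
    refine Finset.prod_dvd_of_coprime ?_ hdiv
    intro k hk l hl hkl
    refine IsCoprime.pow ?_
    exact Polynomial.isCoprime_X_sub_C_of_isUnit_sub
      (sub_ne_zero.2 fun h => hkl (hs hk hl h)).isUnit
  have hcoef : ∀ j, (ν V).coeff j = V.coeff (Finsupp.single a j) := by
    intro j
    conv_lhs => rw [V.as_sum]
    rw [map_sum, Polynomial.finsetSum_coeff]
    have : ∀ e ∈ V.support, (ν (MvPolynomial.monomial e (V.coeff e))).coeff j =
        if e = Finsupp.single a j then V.coeff e else 0 := by
      intro e he
      have hee := hV e (MvPolynomial.mem_support_iff.1 he)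
      have he' : e = Finsupp.single a (e a) := by
        ext i
        by_cases hi : i = a
        · subst hi; simp
        · have := hee i; simp [hi] at this; simp [hi, this]
      rw [he']
      simp only [ν, MvPolynomial.aeval_monomial]
      rw [Finsupp.prod_single_index (by simp)]
      simp only [if_true, Polynomial.algebraMap_eq, Polynomial.coeff_C_mul, Polynomial.coeff_X_pow]
      have hiff : Finsupp.single a (e a) = Finsupp.single a j ↔ j = e a := by
        rw [(Finsupp.single_injective a).eq_iff]; exact eq_comm
      by_cases hj : j = e a
      · simp [hj]
      · simp [hj, hiff]
    rw [Finset.sum_congr rfl this, Finset.sum_ite_eq']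
    split_ifs with h
    · rfl
    · rw [MvPolynomial.mem_support_iff, not_not] at h; exact h.symm
  have hne : ν V ≠ 0 := by
    intro h0
    apply hV0
    ext e
    rw [MvPolynomial.coeff_zero]
    by_contra hce
    have hee := hV e hce
    have he' : e = Finsupp.single a (e a) := by
      ext i
      by_cases hi : i = a
      · subst hi; simp
      · have := hee i; simp [hi] at this; simp [hi, this]
    rw [he', ← hcoef, h0] at hce
    simp at hce
  have hdegB : (ν V).natDegree ≤ B := by
    rw [Polynomial.natDegree_le_iff_coeff_eq_zero]
    intro j hj
    rw [hcoef]
    by_contra h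
    have := hV _ h a
    simp at this; omega
  have := Polynomial.natDegree_le_of_dvd hprod hne
  rw [Polynomial.natDegree_prod_of_monic _ _ (fun k _ => (Polynomial.monic_X_sub_C _).pow c)] at this
  simp only [Polynomial.natDegree_pow, Polynomial.natDegree_X_sub_C, mul_one, Finset.sum_const,
    smul_eq_mul] at this
  omega

/-- combinatorial inequality -/
lemma sum_max {K D : ℕ} (hD : 0 < D) (hK : K ≤ D + 1) {δ : ℝ} (hδ : 0 < δ) (hδ1 : δ ≤ 1) :
    K * (δ ^ 2 / 32) ≤ ∑ j : Fin K, max (δ / 2 - (j : ℕ) * (1 / (D : ℝ))) 0 := by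
  have hDr : (0 : ℝ) < D := by exact_mod_cast hD
  set n0 := min K (⌊D * δ / 4⌋₊ + 1) with hn0
  have h1 : (K : ℝ) * (δ / 8) ≤ n0 := by
    have hKr : (K : ℝ) ≤ D + 1 := by exact_mod_cast hK
    have hD1 : (1 : ℝ) ≤ D := by exact_mod_cast hD
    rw [hn0, Nat.cast_min]
    refine le_min ?_ ?_
    · nlinarith [(Nat.cast_nonneg K : (0 : ℝ) ≤ K)]
    · have := Nat.lt_floor_add_one (D * δ / 4)
      push_cast
      nlinarith
  rw [Fin.sum_univ_eq_sum_range (fun j => max (δ / 2 - (j : ℕ) * (1 / (D : ℝ))) 0) K]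
  have hsub : Finset.range n0 ⊆ Finset.range K := Finset.range_mono (min_le_left _ _)
  refine le_trans ?_ (Finset.sum_le_sum_of_subset_of_nonneg hsub (fun i _ _ => le_max_right _ _))
  have h2 : ∀ j ∈ Finset.range n0, δ / 4 ≤ max (δ / 2 - (j : ℕ) * (1 / (D : ℝ))) 0 := by
    intro j hj
    rw [Finset.mem_range] at hj
    refine le_trans ?_ (le_max_left _ _)
    have hj' : j ≤ ⌊D * δ / 4⌋₊ := by omega
    have : (j : ℝ) ≤ D * δ / 4 := (Nat.cast_le.2 hj').trans (Nat.floor_le (by positivity))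
    have : (j : ℝ) * (1 / (D : ℝ)) ≤ δ / 4 := by
      rw [mul_one_div, div_le_iff₀ hDr]; linarith
    linarith
  refine le_trans ?_ (Finset.card_nsmul_le_sum _ _ _ h2)
  rw [Finset.card_range, nsmul_eq_mul]
  nlinarith

end Bak

namespace Bak

lemma geo_step {r : ℕ} (a : Fin r) (d : Fin r → ℕ) (hd : ∀ i, 0 < d i) {δ ρ : ℝ} (hδ : 0 < δ)
    (hδ1 : δ ≤ 1) (hρ : 0 < ρ) (hρδ : ρ ≤ δ / 2) (hsep : ∀ i, i < a → (d a : ℝ) ≤ ρ * d i)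
    (s : Fin r → ℝ) (P : A r) {K : ℕ} (hK : K ≤ d a + 1) (φ ψ : Fin K → A r)
    (hP : P = ∑ i, φ i * ψ i)
    (hφ : ∀ i, φ i ∈ Box (fun i : Fin r => if i.val < a.val then d i else 0))
    (hψ : ∀ i, ψ i ∈ Box (Pi.single a (d a)))
    (lx ly : Fin K → List (Fin r × ℝ)) (hlx : ∀ i, (lx i).length = i)
    (hly : ∀ i, (ly i).length = i)
    (hlx' : ∀ i, ∀ x ∈ lx i, (fun i : Fin r => if i.val < a.val then d i else 0) x.1 ≠ 0)
    (hly' : ∀ i, ∀ x ∈ ly i, (Pi.single a (d a) : Fin r → ℕ) x.1 ≠ 0)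
    (hidx : IdxGE d s δ P) :
    IdxGE d s (K * (δ ^ 2 / 32)) ((Matrix.of fun i j => opL (lx i) (φ j)).det *
      (Matrix.of fun i j => opL (ly i) (ψ j)).det) := by
  classical
  have hda : (0 : ℝ) < d a := by exact_mod_cast hd a
  have hly'' : ∀ i, ∀ x ∈ ly i, x.1 = a := by
    intro i x hx
    by_contra h
    exact hly' i x hx (by simp [h])
  have hlx'' : ∀ i, ∀ x ∈ lx i, x.1 < a := by
    intro i x hx
    by_contra h
    refine hlx' i x hx ?_
    have : ¬ (x.1.val < a.val) := h
    simp [this]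
  have hmat : (Matrix.of fun i j => opL (lx i) (φ j)) *
      (Matrix.of fun i j => opL (ly i) (ψ j)).transpose =
      Matrix.of fun i j => opL (lx i) (opL (ly j) P) := by
    ext1 i j
    rw [Matrix.mul_apply, Matrix.of_apply, hP, map_sum, map_sum]
    refine Finset.sum_congr rfl fun l _ => ?_
    rw [Matrix.of_apply, Matrix.transpose_apply, Matrix.of_apply, mul_comm (φ l) (ψ l),
      opL_mul (ly j) (ψ l) (φ l) (hφ l), mul_comm _ (φ l),
      opL_mul (lx i) (φ l) _ (opL_Box (ly j) (hψ l))]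
    · intro x hx
      have := hlx'' i x hx
      simp [this.ne]
    · intro x hx
      rw [hly'' j x hx]; simp
  rw [← Matrix.det_transpose (Matrix.of fun i j => opL (ly i) (ψ j)), ← Matrix.det_mul, hmat]
  refine IdxGE.mono (IdxGE.det (θ := fun j : Fin K => max (δ / 2 - (j : ℕ) * (1 / (d a : ℝ))) 0)
    _ ?_) (sum_max (hd a) hK hδ hδ1)
  intro i j
  rw [Matrix.of_apply]
  rcases le_total 0 (δ / 2 - (j : ℕ) * (1 / (d a : ℝ))) with h | h
  swap
  · rw [max_eq_right h]; exact IdxGE.zero _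
  rw [max_eq_left h]
  have h1 := hidx.opL (ly j) (w := 1 / (d a : ℝ)) (fun x hx => by rw [hly'' j x hx])
  have h2 := h1.opL (lx i) (w := ρ / (d a : ℝ)) (fun x hx => by
    have := hsep _ (hlx'' i x hx)
    have hx0 : (0 : ℝ) < d x.1 := by exact_mod_cast hd x.1
    rw [div_le_div_iff₀ hx0 hda]; linarith)
  refine h2.mono ?_
  rw [hlx, hly]
  have hi : ((i : ℕ) : ℝ) ≤ d a := by
    have := i.2
    exact_mod_cast (by omega : (i : ℕ) ≤ d a)
  have : ((i : ℕ) : ℝ) * (ρ / d a) ≤ ρ := by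
    rw [mul_div_assoc', div_le_iff₀ hda]; nlinarith
  linarith

theorem geo (r : ℕ) : ∀ m : ℕ, m ≤ r → ∀ δ : ℝ, 0 < δ → ∃ M : ℕ, ∃ ρ : ℝ, 0 < ρ ∧
    ∀ d : Fin r → ℕ, (∀ i, 0 < d i) → (∀ i j, i < j → (d j : ℝ) ≤ ρ * d i) →
    ∀ (S : Finset ℕ) (s : ℕ → Fin r → ℝ), (∀ i, Set.InjOn (fun k => s k i) S) → M ≤ S.card →
    ∀ P : A r, P ≠ 0 → P ∈ Box (fun i : Fin r => if i.val < m then d i else 0) →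
    ∃ k ∈ S, ∃ e, (shift (s k) P).coeff e ≠ 0 ∧ wt d e ≤ δ := by
  classical
  intro m
  induction m with
  | zero =>
    intro _ δ hδ
    refine ⟨1, 1, one_pos, ?_⟩
    intro d hd hsep S s hs hM P hP0 hP
    obtain ⟨k, hk⟩ := Finset.card_pos.1 hM
    refine ⟨k, hk, 0, ?_, by simp [wt]; exact hδ.le⟩
    have hne : shift (s k) P ≠ 0 := by
      have hPC : P = MvPolynomial.C (P.coeff 0) := by
        ext e
        rw [MvPolynomial.coeff_C]
        split_ifs with h
        · rw [h]
        · by_contra h'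
          have := hP e h'
          exact h (Finsupp.ext fun i => by have h2 := this i; simp at h2; simp [h2])
      rw [hPC, shift, MvPolynomial.aeval_C]
      intro h
      apply hP0
      rw [hPC]; exact h
    have hB := shift_Box (s k) hP
    intro h0
    apply hne
    ext e
    rw [MvPolynomial.coeff_zero]
    by_contra h
    have := hB e h
    have he : e = 0 := Finsupp.ext fun i => by simpa using this i
    rw [he] at h
    exact h h0
  | succ m ih =>
    intro hm
    suffices H : ∀ δ : ℝ, 0 < δ → δ ≤ 1 → ∃ M : ℕ, ∃ ρ : ℝ, 0 < ρ ∧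
      ∀ d : Fin r → ℕ, (∀ i, 0 < d i) → (∀ i j, i < j → (d j : ℝ) ≤ ρ * d i) →
      ∀ (S : Finset ℕ) (s : ℕ → Fin r → ℝ), (∀ i, Set.InjOn (fun k => s k i) S) → M ≤ S.card →
      ∀ P : A r, P ≠ 0 → P ∈ Box (fun i : Fin r => if i.val < m + 1 then d i else 0) →
      ∃ k ∈ S, ∃ e, (shift (s k) P).coeff e ≠ 0 ∧ wt d e ≤ δ by
      intro δ hδ
      obtain ⟨M, ρ, hρ, h⟩ := H (min δ 1) (lt_min hδ one_pos) (min_le_right _ _)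
      refine ⟨M, ρ, hρ, ?_⟩
      intro d hd hsep S s hs hM P hP0 hP
      obtain ⟨k, hk, e, he, hw⟩ := h d hd hsep S s hs hM P hP0 hP
      exact ⟨k, hk, e, he, hw.trans (min_le_left _ _)⟩
    intro δ hδ hδ1
    set δ' := δ ^ 2 / 100 with hδ'
    have hδ'0 : 0 < δ' := by positivity
    obtain ⟨M₁, ρ₁, hρ₁, IH⟩ := ih (by omega) δ' hδ'0
    refine ⟨M₁ + ⌈1 / δ'⌉₊ , min ρ₁ (δ / 2), by positivity, ?_⟩
    intro d hd hsep S s hs hM P hP0 hP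
    set a : Fin r := ⟨m, hm⟩ with ha
    have hda : (0 : ℝ) < d a := by exact_mod_cast hd a
    set bx : Fin r → ℕ := fun i => if i.val < a.val then d i else 0 with hbx
    have hbxa : bx a = 0 := by simp [hbx]
    have hPB : P ∈ Box (bx + Pi.single a (d a)) := by
      refine Box_mono (fun i => ?_) hP
      by_cases hi : i = a
      · subst hi; simp [ha]
      · have : i.val ≠ m := fun h => hi (Fin.ext h)
        simp only [hbx, ha, Pi.add_apply]
        split_ifs <;> first | omega | simp
    obtain ⟨K, hK, φ, ψ, hφ, hψ, hPs, hφi, hψi⟩ :=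
      decomp (Box bx) (Box (Pi.single a (d a))) P (d a + 1) (decomp_start a bx hbxa (d a) P hPB)
    have hK0 : 0 < K := by
      rcases Nat.eq_zero_or_pos K with h | h
      · subst h; exact absurd (by simpa using hPs) hP0
      · exact h
    have hKr : (0 : ℝ) < K := by exact_mod_cast hK0
    obtain ⟨lx, hlx, hlx', hU⟩ := wronskian φ hφi hφ
    obtain ⟨ly, hly, hly', hV⟩ := wronskian ψ hψi hψ
    set U := (Matrix.of fun i j => opL (lx i) (φ j)).det with hUdef
    set V := (Matrix.of fun i j => opL (ly i) (ψ j)).det with hVdef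
    have hUB : U ∈ Box (K • bx) := Box_det _ fun i j => opL_Box _ (hφ j)
    have hVB : V ∈ Box (K • Pi.single a (d a)) := Box_det _ fun i j => opL_Box _ (hψ j)
    -- good points for `U`
    let gU : ℕ → Prop := fun k => ∃ e, (shift (s k) U).coeff e ≠ 0 ∧ wt d e ≤ K * δ'
    let gV : ℕ → Prop := fun k => ∃ e, (shift (s k) V).coeff e ≠ 0 ∧ wt d e ≤ K * δ'
    have hS1 : (S.filter (fun k => ¬ gU k)).card < M₁ := by
      by_contra! hcard
      obtain ⟨k, hk, e, he, hw⟩ := IH (fun i => K * d i) (fun i => Nat.mul_pos hK0 (hd i))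
        (fun i j hij => by
          have h1 := hsep i j hij
          have h2 : min ρ₁ (δ / 2) * (d i : ℝ) ≤ ρ₁ * d i :=
            mul_le_mul_of_nonneg_right (min_le_left _ _) (Nat.cast_nonneg _)
          push_cast
          have := mul_le_mul_of_nonneg_left (h1.trans h2) hKr.le
          linarith)
        (S.filter (fun k => ¬ gU k)) s
        (fun i => (hs i).mono (by intro x hx; exact (Finset.mem_filter.1 hx).1)) hcard U hU
        (Box_mono (fun i => by
          simp only [hbx, ha, Pi.smul_apply, smul_eq_mul]; split_ifs <;> simp) hUB)
      refine (Finset.mem_filter.1 hk).2 ⟨e, he, ?_⟩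
      have : wt (fun i => K * d i) e = wt d e / K := by
        unfold wt
        rw [Finset.sum_div]
        refine Finset.sum_congr rfl fun i _ => ?_
        push_cast
        rw [mul_comm, div_div]
      rw [this, div_le_iff₀ hKr] at hw
      linarith
    have hS2 : (S.filter (fun k => ¬ gV k)).card < ⌈1 / δ'⌉₊ := by
      by_contra! hcard
      have hKd : (0 : ℝ) < K * d a := by positivity
      have hVB' : V ∈ Box (Pi.single a (K * d a)) := by
        refine Box_mono (fun i => ?_) hVB
        by_cases hi : i = a
        · subst hi; simp
        · simp [hi]
      obtain ⟨k, hk, e, he, hlt⟩ := one_var a (K * d a) (⌊(K * d a : ℝ) * δ'⌋₊ + 1) V hV hVB'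
        (S.filter (fun k => ¬ gV k)) s
        ((hs a).mono (by intro x hx; exact (Finset.mem_filter.1 hx).1)) (by
          have h1 : (1 / δ' : ℝ) ≤ (S.filter (fun k => ¬ gV k)).card :=
            (Nat.le_ceil _).trans (by exact_mod_cast hcard)
          have h2 := Nat.lt_floor_add_one ((K * d a : ℝ) * δ')
          have : ((K * d a : ℕ) : ℝ) < ((S.filter (fun k => ¬ gV k)).card *
              (⌊(K * d a : ℝ) * δ'⌋₊ + 1) : ℕ) := by
            push_cast
            calc (K * d a : ℝ) = 1 / δ' * ((K * d a : ℝ) * δ') := by field_simp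
              _ < 1 / δ' * (⌊(K * d a : ℝ) * δ'⌋₊ + 1) :=
                mul_lt_mul_of_pos_left h2 (by positivity)
              _ ≤ _ := mul_le_mul_of_nonneg_right h1 (by positivity)
          exact_mod_cast this)
      refine (Finset.mem_filter.1 hk).2 ⟨e, he, ?_⟩
      have hB := shift_Box (s k) hVB' e he
      have hw : wt d e = (e a : ℝ) / d a := by
        unfold wt
        rw [Finset.sum_eq_single a]
        · intro b _ hb
          have := hB b
          simp [hb] at this
          simp [this]
        · simp
      rw [hw, div_le_iff₀ hda]
      have : (e a : ℝ) ≤ ⌊(K * d a : ℝ) * δ'⌋₊ := by exact_mod_cast Nat.lt_succ_iff.1 hlt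
      have := this.trans (Nat.floor_le (by positivity))
      linarith
    have hex : ∃ k ∈ S, gU k ∧ gV k := by
      by_contra! hno
      have hsub : S ⊆ S.filter (fun k => ¬ gU k) ∪ S.filter (fun k => ¬ gV k) := by
        intro k hk
        rw [Finset.mem_union, Finset.mem_filter, Finset.mem_filter]
        by_cases h : gU k
        · exact Or.inr ⟨hk, hno k hk h⟩
        · exact Or.inl ⟨hk, h⟩
      have h1 := Finset.card_le_card hsub
      have h2 := Finset.card_union_le (S.filter (fun k => ¬ gU k)) (S.filter (fun k => ¬ gV k))
      omega
    obtain ⟨k, hk, ⟨x, hx, hxw⟩, ⟨y, hy, hyw⟩⟩ := hex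
    refine ⟨k, hk, ?_⟩
    by_contra! hno
    have hidx : IdxGE d (s k) δ P := fun e he => (hno e he).le
    have hstep := geo_step a d hd hδ hδ1 (by positivity : 0 < min ρ₁ (δ / 2)) (min_le_right _ _)
      (fun i hi => hsep i a hi) (s k) P hK φ ψ hPs hφ hψ lx ly hlx hly hlx' hly' hidx
    have hne : (shift (s k) (U * V)).coeff (x + y) ≠ 0 := by
      rw [map_mul]
      refine coeff_mul_disjoint (b := K • bx) (c := K • Pi.single a (d a)) ?_ (shift_Box _ hUB)
        (shift_Box _ hVB) hx hy
      intro i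
      by_cases hi : i = a
      · left; subst hi; simp [hbxa]
      · right; simp [hi]
    have := hstep _ hne
    rw [wt_add] at this
    have h3 : K * (δ ^ 2 / 32) ≤ K * δ' + K * δ' := by linarith
    rw [hδ'] at h3
    nlinarith [mul_pos hKr (pow_pos hδ 2)]

end Bak

namespace Bak

/-- exponent vectors below `d` -/
abbrev Bt {r : ℕ} (d : Fin r → ℕ) := (i : Fin r) → Fin (d i + 1)

/-- the associated finitely supported function -/
noncomputable def fs {r : ℕ} (e : Fin r → ℕ) : Fin r →₀ ℕ := Finsupp.equivFunOnFinite.symm e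

@[simp] lemma fs_apply {r : ℕ} (e : Fin r → ℕ) (i : Fin r) : fs e i = e i := rfl

lemma fs_inj {r : ℕ} {e f : Fin r → ℕ} : fs e = fs f ↔ e = f :=
  Finsupp.equivFunOnFinite.symm.injective.eq_iff

/-- value vector of an index -/
def vl {r : ℕ} {d : Fin r → ℕ} (e : Bt d) : Fin r → ℕ := fun i => (e i : ℕ)

lemma vl_inj {r : ℕ} {d : Fin r → ℕ} {e f : Bt d} : vl e = vl f ↔ e = f := by
  constructor
  · intro h; funext i; exact Fin.ext (congrFun h i)
  · rintro rfl; rfl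

lemma vl_le {r : ℕ} {d : Fin r → ℕ} (e : Bt d) (i : Fin r) : vl e i ≤ d i := by
  have := (e i).2
  simp only [vl]; omega

/-- polynomial with given coefficients -/
noncomputable def poly {r : ℕ} {d : Fin r → ℕ} (c : Bt d → ℝ) : A r :=
  ∑ e : Bt d, MvPolynomial.monomial (fs (vl e)) (c e)

/-- coefficient of the translate -/
noncomputable def sco {r : ℕ} {d : Fin r → ℕ} (c : Bt d → ℝ) (z : Fin r → ℝ) (t : Fin r → ℕ) : ℝ :=
  ∑ e : Bt d, c e * ∏ i, ((vl e i).choose (t i) : ℝ) * z i ^ (vl e i - t i)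

lemma coeff_poly {r : ℕ} {d : Fin r → ℕ} (c : Bt d → ℝ) (e : Bt d) :
    (poly c).coeff (fs (vl e)) = c e := by
  classical
  rw [poly, MvPolynomial.coeff_sum, Finset.sum_eq_single e]
  · simp
  · intro b _ hb
    rw [MvPolynomial.coeff_monomial, if_neg]
    rw [fs_inj, vl_inj]; exact hb
  · simp

lemma poly_Box {r : ℕ} {d : Fin r → ℕ} (c : Bt d → ℝ) : poly c ∈ Box d := by
  classical
  refine Submodule.sum_mem _ fun e _ => ?_
  intro f hf i
  rw [MvPolynomial.coeff_monomial] at hf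
  split_ifs at hf with h
  · rw [← h]; exact vl_le e i
  · exact absurd rfl hf

lemma eq_poly {r : ℕ} {d : Fin r → ℕ} {Q : A r} (hQ : Q ∈ Box d) :
    Q = poly (fun t : Bt d => Q.coeff (fs (vl t))) := by
  ext e
  by_cases h : ∀ i, e i ≤ d i
  · let e' : Bt d := fun i => ⟨e i, Nat.lt_succ_of_le (h i)⟩
    have he : e = fs (vl e') := by ext i; rfl
    rw [he, coeff_poly]
  · have h1 : Q.coeff e = 0 := by by_contra h'; exact h (hQ e h')
    have h2 : (poly (fun t : Bt d => Q.coeff (fs (vl t)))).coeff e = 0 := by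
      by_contra h'; exact h (poly_Box _ e h')
    rw [h1, h2]

lemma coeff_prod_shift {r : ℕ} (e t : Fin r → ℕ) (z : Fin r → ℝ) :
    (∏ i, (MvPolynomial.X i + MvPolynomial.C (z i) : A r) ^ (e i)).coeff (fs t)
      = ∏ i, ((e i).choose (t i) : ℝ) * z i ^ (e i - t i) := by
  classical
  have h1 : ∀ i, (MvPolynomial.X i + MvPolynomial.C (z i) : A r) ^ (e i)
      = ∑ k ∈ Finset.range (e i + 1), MvPolynomial.monomial (Finsupp.single i k)
          (((e i).choose k : ℝ) * z i ^ (e i - k)) := by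
    intro i
    rw [add_pow]
    refine Finset.sum_congr rfl fun k _ => ?_
    rw [MvPolynomial.X_pow_eq_monomial, ← MvPolynomial.C_pow,
      show ((e i).choose k : A r) = MvPolynomial.C ((e i).choose k : ℝ) by simp,
      mul_assoc, ← MvPolynomial.C_mul, mul_comm, MvPolynomial.C_mul_monomial, mul_one, mul_comm]
  simp only [h1]
  rw [Finset.prod_univ_sum, MvPolynomial.coeff_sum]
  have h2 : ∀ k : Fin r → ℕ, (∏ i, MvPolynomial.monomial (Finsupp.single i (k i))
          (((e i).choose (k i) : ℝ) * z i ^ (e i - k i)) : A r)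
        = MvPolynomial.monomial (fs k) (∏ i, ((e i).choose (k i) : ℝ) * z i ^ (e i - k i)) := by
    intro k
    rw [← MvPolynomial.monomial_sum_prod]
    have : (∑ i, Finsupp.single i (k i)) = fs k := by
      ext i
      simp [Finsupp.finsetSum_apply, Finsupp.single_apply]
    rw [this]
  simp only [h2, MvPolynomial.coeff_monomial, fs_inj]
  by_cases ht : ∀ i, t i ≤ e i
  · rw [Finset.sum_eq_single t]
    · simp
    · intro b _ hb; rw [if_neg hb]
    · intro h
      exfalso; apply h
      rw [Fintype.mem_piFinset]
      intro i; exact Finset.mem_range.2 (Nat.lt_succ_of_le (ht i))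
  · rw [Finset.sum_eq_zero]
    · push Not at ht
      obtain ⟨i, hi⟩ := ht
      symm
      apply Finset.prod_eq_zero (Finset.mem_univ i)
      rw [Nat.choose_eq_zero_of_lt hi]; simp
    · intro k hk
      rw [if_neg]
      rintro rfl
      apply ht
      intro i
      have := Fintype.mem_piFinset.1 hk i
      exact Nat.le_of_lt_succ (Finset.mem_range.1 this)

lemma coeff_shift_poly {r : ℕ} {d : Fin r → ℕ} (c : Bt d → ℝ) (z : Fin r → ℝ) (t : Fin r → ℕ) :
    (shift z (poly c)).coeff (fs t) = sco c z t := by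
  rw [poly, map_sum, MvPolynomial.coeff_sum, sco]
  refine Finset.sum_congr rfl fun e _ => ?_
  rw [shift_monomial, MvPolynomial.coeff_smul, smul_eq_mul, ← coeff_prod_shift]
  rfl

lemma shift_comp {r : ℕ} (s z : Fin r → ℝ) (P : A r) :
    shift s P = shift (fun i => s i - z i) (shift z P) := by
  have : shift s = (shift (fun i => s i - z i)).comp (shift z) := by
    apply MvPolynomial.algHom_ext
    intro i
    simp [shift]
    ring
  rw [this]; rfl

lemma sco_comp {r : ℕ} {d : Fin r → ℕ} (c : Bt d → ℝ) (s z : Fin r → ℝ) (e : Fin r → ℕ) :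
    sco c s e = sco (d := d) (fun t => sco c z (vl t)) (fun i => s i - z i) e := by
  rw [← coeff_shift_poly, shift_comp s z, eq_poly (shift_Box z (poly_Box c)), coeff_shift_poly]
  simp only [coeff_shift_poly]

end Bak

namespace Bak

lemma pseudo_div (F : ℤ[X]) (n : ℕ) (hn : F.natDegree = n) (hn1 : 1 ≤ n) (H : ℕ) (hH1 : 1 ≤ H)
    (hH : ∀ j, |F.coeff j| ≤ (H : ℤ)) (ξ : ℝ) (k : ℕ) :
    ∃ ρ g : ℤ[X], C (F.leadingCoeff ^ k) * X ^ k = g * F + ρ ∧ (∀ j, n ≤ j → ρ.coeff j = 0) ∧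
      (∀ j, |ρ.coeff j| ≤ (2 * (H : ℤ)) ^ k) ∧ |aeval ξ g| ≤ (4 * (H : ℝ) * (1 + |ξ|)) ^ k := by
  induction k with
  | zero =>
    refine ⟨1, 0, by simp, ?_, ?_, by simp⟩
    · intro j hj
      rw [coeff_one, if_neg (by omega)]
    · intro j
      rw [coeff_one]
      split_ifs <;> simp
  | succ k ih =>
    obtain ⟨ρ, g, h1, h2, h3, h4⟩ := ih
    set a := F.leadingCoeff with ha
    set b := ρ.coeff (n - 1) with hb
    have haH : |a| ≤ (H : ℤ) := hH _
    have hz : (0 : ℤ) ≤ (2 * (H : ℤ)) ^ k := by positivity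
    refine ⟨C a * (X * ρ) - C b * F, C a * (X * g) + C b, ?_, ?_, ?_, ?_⟩
    · rw [pow_succ, C_mul, pow_succ]
      linear_combination (C a * X) * h1
    · intro j hj
      rw [coeff_sub, coeff_C_mul, coeff_C_mul]
      obtain ⟨i, rfl⟩ : ∃ i, j = i + 1 := ⟨j - 1, by omega⟩
      rw [coeff_X_mul]
      rcases Nat.lt_or_ge n (i + 1) with h | h
      · rw [h2 i (by omega), coeff_eq_zero_of_natDegree_lt (by omega)]; ring
      · have : n = i + 1 := by omega
        have hi : i = n - 1 := by omega
        have h5 : F.coeff (i + 1) = a := by rw [← this, ← hn]; rfl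
        rw [h5, hi, ← hb]; ring
    · intro j
      rw [coeff_sub, coeff_C_mul, coeff_C_mul]
      have e1 : |a * (X * ρ).coeff j| ≤ H * (2 * (H : ℤ)) ^ k := by
        rw [abs_mul]
        refine mul_le_mul haH ?_ (abs_nonneg _) (by positivity)
        cases j with
        | zero => simp; 
        | succ i => rw [coeff_X_mul]; exact h3 i
      have e2 : |b * F.coeff j| ≤ (2 * (H : ℤ)) ^ k * H := by
        rw [abs_mul]
        exact mul_le_mul (h3 _) (hH j) (abs_nonneg _) hz
      have := abs_sub (a * (X * ρ).coeff j) (b * F.coeff j)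
      rw [pow_succ]; linarith
    · have e0 : aeval ξ (C a * (X * g) + C b) = a * (ξ * aeval ξ g) + b := by simp
      rw [e0]
      have e1 : |(a : ℝ)| ≤ H := by exact_mod_cast haH
      have e2 : |(b : ℝ)| ≤ (2 * (H : ℝ)) ^ k := by exact_mod_cast h3 (n - 1)
      have hH1' : (1 : ℝ) ≤ H := by exact_mod_cast hH1
      have hx := abs_nonneg ξ
      have e3 : (2 * (H : ℝ)) ^ k ≤ (4 * (H : ℝ) * (1 + |ξ|)) ^ k := by
        apply pow_le_pow_left₀ (by positivity)
        nlinarith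
      set B := (4 * (H : ℝ) * (1 + |ξ|)) ^ k with hB
      have hB0 : 0 ≤ B := by positivity
      have e4 : |(a : ℝ) * (ξ * aeval ξ g)| ≤ H * ((1 + |ξ|) * B) := by
        rw [abs_mul, abs_mul]
        have : |ξ| * |aeval ξ g| ≤ (1 + |ξ|) * B :=
          mul_le_mul (by linarith) h4 (abs_nonneg _) (by positivity)
        exact mul_le_mul e1 this (by positivity) (by positivity)
      have e5 := abs_add_le ((a : ℝ) * (ξ * aeval ξ g)) b
      rw [pow_succ, ← hB]
      have e6 : B ≤ H * ((1 + |ξ|) * B) := by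
        have : 1 * B ≤ (H * (1 + |ξ|)) * B := by
          apply mul_le_mul_of_nonneg_right _ hB0
          nlinarith
        linarith
      have e7 : 0 ≤ H * ((1 + |ξ|) * B) := by positivity
      nlinarith

/-- Chebyshev: few exponent vectors are low. -/
lemma sq_sum {r : ℕ} (d : Fin r → ℕ) (hd : ∀ i, 0 < d i) :
    ∑ t : ((i : Fin r) → Fin (d i + 1)), (∑ i, (((t i : ℕ) : ℝ) / d i - 1 / 2)) ^ 2
      ≤ (Fintype.card ((i : Fin r) → Fin (d i + 1)) : ℝ) * (r / 4) := by
  classical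
  have h1 : ∀ i j : Fin r, i ≠ j → ∑ t : ((i : Fin r) → Fin (d i + 1)),
      (((t i : ℕ) : ℝ) / d i - 1 / 2) * (((t j : ℕ) : ℝ) / d j - 1 / 2) = 0 := by
    intro i j hij
    have hinv : Function.Involutive (fun t : ((i : Fin r) → Fin (d i + 1)) =>
        Function.update t i (Fin.rev (t i))) := by
      intro t; simp
    have := Equiv.sum_comp (hinv.toPerm _) (fun t : ((i : Fin r) → Fin (d i + 1)) =>
      (((t i : ℕ) : ℝ) / d i - 1 / 2) * (((t j : ℕ) : ℝ) / d j - 1 / 2))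
    have h2 : ∀ t : ((i : Fin r) → Fin (d i + 1)),
       (((((hinv.toPerm _) t) i : ℕ) : ℝ) / d i - 1 / 2) * (((((hinv.toPerm _) t) j : ℕ) : ℝ) / d j - 1 / 2)
        = - ((((t i : ℕ) : ℝ) / d i - 1 / 2) * (((t j : ℕ) : ℝ) / d j - 1 / 2)) := by
      intro t
      have e1 : ((hinv.toPerm _) t) i = Fin.rev (t i) := by simp [Function.Involutive.coe_toPerm]
      have e2 : ((hinv.toPerm _) t) j = t j := by
        simp [Function.Involutive.coe_toPerm, Function.update_of_ne hij.symm]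
      rw [e1, e2, Fin.val_rev]
      have h3 : d i + 1 - ((t i : ℕ) + 1) = d i - (t i : ℕ) := by omega
      have h4 : (t i : ℕ) ≤ d i := by have := (t i).2; omega
      rw [h3, Nat.cast_sub h4]
      have h5 : (d i : ℝ) ≠ 0 := by exact_mod_cast (hd i).ne'
      rw [sub_div, div_self h5]; ring
    simp only [h2, Finset.sum_neg_distrib] at this
    linarith
  have h2 : ∀ t : ((i : Fin r) → Fin (d i + 1)), (∑ i, (((t i : ℕ) : ℝ) / d i - 1 / 2)) ^ 2
      = ∑ i, ∑ j, (((t i : ℕ) : ℝ) / d i - 1 / 2) * (((t j : ℕ) : ℝ) / d j - 1 / 2) := by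
    intro t
    rw [pow_two, Finset.sum_mul_sum]
  simp only [h2]
  rw [Finset.sum_comm]
  have h3 : ∀ i : Fin r, ∑ t : ((i : Fin r) → Fin (d i + 1)), ∑ j,
      (((t i : ℕ) : ℝ) / d i - 1 / 2) * (((t j : ℕ) : ℝ) / d j - 1 / 2)
      ≤ (Fintype.card ((i : Fin r) → Fin (d i + 1)) : ℝ) * (1 / 4) := by
    intro i
    rw [Finset.sum_comm, Finset.sum_eq_single i]
    · rw [← nsmul_eq_mul]
      apply Finset.sum_le_card_nsmul
      intro t _
      have h4 : (((t i : ℕ) : ℝ)) ≤ d i := by have := (t i).2; exact_mod_cast (by omega)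
      have h5 : (0 : ℝ) < d i := by exact_mod_cast hd i
      have h6 : ((t i : ℕ) : ℝ) / d i ≤ 1 := by rw [div_le_one h5]; exact h4
      have h7 : 0 ≤ ((t i : ℕ) : ℝ) / d i := by positivity
      nlinarith
    · intro j _ hj; exact h1 i j hj.symm
    · simp
  refine (Finset.sum_le_sum fun i _ => h3 i).trans ?_
  rw [Finset.sum_const, Finset.card_univ, Fintype.card_fin, nsmul_eq_mul]
  exact le_of_eq (by ring)

lemma low_count {r : ℕ} (d : Fin r → ℕ) (hd : ∀ i, 0 < d i) (η : ℝ) (hη : 0 < η) (m : ℕ)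
    (hr : (m : ℝ) / (2 * η ^ 2) ≤ r) (hr0 : 0 < r)
    [Fintype {t : ((i : Fin r) → Fin (d i + 1)) // ∑ i, ((t i : ℕ) : ℝ) / d i < (1 / 2 - η) * r}] :
    2 * m * Fintype.card {t : ((i : Fin r) → Fin (d i + 1)) // ∑ i, ((t i : ℕ) : ℝ) / d i < (1 / 2 - η) * r}
      ≤ Fintype.card ((i : Fin r) → Fin (d i + 1)) := by
  classical
  have h := sq_sum d hd
  set L := Finset.univ.filter (fun t : ((i : Fin r) → Fin (d i + 1)) =>
    ∑ i, ((t i : ℕ) : ℝ) / d i < (1 / 2 - η) * r) with hL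
  have hc : Fintype.card {t : ((i : Fin r) → Fin (d i + 1)) // ∑ i, ((t i : ℕ) : ℝ) / d i < (1 / 2 - η) * r}
     = L.card := by
    rw [hL]; exact Fintype.card_subtype _
  rw [hc]
  have hr0' : (0 : ℝ) < r := by exact_mod_cast hr0
  have h1 : (L.card : ℝ) * (η * r) ^ 2 ≤
      ∑ t : ((i : Fin r) → Fin (d i + 1)), (∑ i, (((t i : ℕ) : ℝ) / d i - 1 / 2)) ^ 2 := by
    rw [← nsmul_eq_mul]
    refine (Finset.card_nsmul_le_sum L _ _ ?_).trans
      (Finset.sum_le_sum_of_subset_of_nonneg (Finset.subset_univ L) (fun t _ _ => sq_nonneg _))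
    intro t ht
    have ht := (Finset.mem_filter.1 ht).2
    rw [Finset.sum_sub_distrib, Finset.sum_const, Finset.card_univ, Fintype.card_fin, nsmul_eq_mul]
    have : 0 < η * r := by positivity
    nlinarith
  have h2 := h1.trans h
  rw [div_le_iff₀ (by positivity)] at hr
  have h3 : (2 * m * L.card : ℝ) ≤ Fintype.card ((i : Fin r) → Fin (d i + 1)) := by
    have h4 : (2 * m * L.card : ℝ) * (r / 4) ≤ Fintype.card ((i : Fin r) → Fin (d i + 1)) * (r / 4) := by
      refine le_trans ?_ h2
      have h5 : (m : ℝ) * (L.card * r) ≤ (r * (2 * η ^ 2)) * (L.card * r) :=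
        mul_le_mul_of_nonneg_right hr (by positivity)
      nlinarith
    exact le_of_mul_le_mul_right h4 (by positivity)
  exact_mod_cast h3

end Bak

namespace Bak

lemma siegel {α β : Type*} [Fintype α] [Fintype β] (M : α → β → ℤ) (B : ℝ) (hB : 1 ≤ B)
    (hM : ∀ i j, |(M i j : ℝ)| ≤ B) (h0 : 0 < Fintype.card α)
    (h2 : 2 * Fintype.card α ≤ Fintype.card β) :
    ∃ c : β → ℤ, c ≠ 0 ∧ (∀ i, ∑ j, M i j * c j = 0) ∧ ∀ j, |(c j : ℝ)| ≤ Fintype.card β * B := by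
  obtain ⟨c, hc, hA, hn⟩ := Int.Matrix.exists_ne_zero_int_vec_norm_le (Matrix.of M) (by omega) h0
  refine ⟨c, hc, fun i => ?_, fun j => ?_⟩
  · have := congrFun hA i
    simpa [Matrix.mulVec, dotProduct] using this
  · have h1 : ‖c j‖ ≤ ‖c‖ := norm_le_pi_norm c j
    rw [Int.norm_eq_abs] at h1
    refine h1.trans (hn.trans ?_)
    have hβ : (1 : ℝ) ≤ Fintype.card β := by exact_mod_cast (by omega)
    have hle : @norm _ (Matrix.seminormedAddCommGroup).toNorm (Matrix.of M) ≤ B := by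
      rw [Matrix.norm_le_iff (by linarith)]
      intro i j
      rw [Int.norm_eq_abs]; exact hM i j
    have hmax : max 1 (@norm _ (Matrix.seminormedAddCommGroup).toNorm (Matrix.of M)) ≤ B :=
      max_le hB hle
    have h3 : (2 : ℝ) * Fintype.card α ≤ Fintype.card β := by exact_mod_cast h2
    have h4 : (0 : ℝ) < Fintype.card α := by exact_mod_cast h0
    have hbase : (1 : ℝ) ≤ Fintype.card β *
        max 1 (@norm _ (Matrix.seminormedAddCommGroup).toNorm (Matrix.of M)) := by
      have := le_max_left 1 (@norm _ (Matrix.seminormedAddCommGroup).toNorm (Matrix.of M))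
      nlinarith
    have hexp : (Fintype.card α : ℝ) / (Fintype.card β - Fintype.card α) ≤ 1 := by
      rw [div_le_one (by linarith)]; linarith
    refine (Real.rpow_le_rpow_of_exponent_le hbase hexp).trans ?_
    rw [Real.rpow_one]
    exact mul_le_mul_of_nonneg_left hmax (by linarith)

lemma card_Bt {r : ℕ} (d : Fin r → ℕ) : (Fintype.card (Bt d) : ℝ) ≤ 2 ^ (∑ i, d i) := by
  have : Fintype.card (Bt d) ≤ 2 ^ (∑ i, d i) := by
    rw [Fintype.card_pi, ← Finset.prod_pow_eq_pow_sum]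
    refine Finset.prod_le_prod' fun i _ => ?_
    rw [Fintype.card_fin]
    exact Nat.lt_two_pow_self
  exact_mod_cast this

lemma choose_prod {r : ℕ} {d : Fin r → ℕ} (e : Bt d) (t : Fin r → ℕ) :
    ∏ i, ((vl e i).choose (t i) : ℝ) ≤ 2 ^ (∑ i, d i) := by
  rw [← Finset.prod_pow_eq_pow_sum]
  refine Finset.prod_le_prod (fun i _ => by positivity) fun i _ => ?_
  have h : (vl e i).choose (t i) ≤ 2 ^ (d i) :=
    (Nat.choose_le_two_pow _ _).trans (Nat.pow_le_pow_right (by norm_num) (vl_le e i))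
  exact_mod_cast h

lemma kk_le {r : ℕ} {d : Fin r → ℕ} (e : Bt d) (t : Fin r → ℕ) :
    ∑ i, (vl e i - t i) ≤ ∑ i, d i :=
  Finset.sum_le_sum fun i _ => (Nat.sub_le _ _).trans (vl_le e i)

lemma pow_mul_pow_le {x y : ℝ} {k K : ℕ} (hx : 1 ≤ x) (hxy : x ≤ y) (hk : k ≤ K) :
    x ^ (K - k) * y ^ k ≤ y ^ K := by
  calc x ^ (K - k) * y ^ k ≤ y ^ (K - k) * y ^ k := by
        have : 0 ≤ y := by linarith
        gcongr
    _ = y ^ K := by rw [← pow_add]; congr 1; omega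

theorem aux_poly (F : ℤ[X]) (n m : ℕ) (hn : F.natDegree = n) (hn1 : 1 ≤ n) (hnm : n ≤ m)
    (H : ℕ) (hH1 : 1 ≤ H) (hH : ∀ j, |F.coeff j| ≤ (H : ℤ)) (ξ : ℝ) {r : ℕ} (hr0 : 0 < r)
    (d : Fin r → ℕ) (hd : ∀ i, 0 < d i) (η : ℝ) (hη : 0 < η) (hη2 : η < 1 / 2)
    (hr : (m : ℝ) / (2 * η ^ 2) ≤ r) :
    ∃ c : Bt d → ℤ, c ≠ 0 ∧
      (∀ t : Bt d, |sco (fun e => (c e : ℝ)) (fun _ => ξ) (vl t)|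
          ≤ (128 * (H : ℝ) ^ 2 * (1 + |ξ|)) ^ (∑ i, d i)) ∧
      (∀ t : Bt d, ∑ i, ((t i : ℕ) : ℝ) / d i < (1 / 2 - η) * r →
        |sco (fun e => (c e : ℝ)) (fun _ => ξ) (vl t)|
          ≤ |aeval ξ F| * (128 * (H : ℝ) ^ 2 * (1 + |ξ|)) ^ (∑ i, d i)) := by
  classical
  choose ρ g hdiv hdeg hρ hg using pseudo_div F n hn hn1 H hH1 hH ξ
  set K := ∑ i, d i with hK
  set a := F.leadingCoeff with ha
  have hH1' : (1 : ℝ) ≤ H := by exact_mod_cast hH1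
  have hr0' : (0 : ℝ) < r := by exact_mod_cast hr0
  have hxi := abs_nonneg ξ
  have ha0 : a ≠ 0 := by
    rw [ha, Ne, leadingCoeff_eq_zero]; rintro rfl; simp at hn; omega
  have ha1 : (1 : ℝ) ≤ |(a : ℝ)| := by exact_mod_cast Int.one_le_abs ha0
  have haH : |(a : ℝ)| ≤ H := by exact_mod_cast hH _
  let Lo := {t : Bt d // ∑ i, ((t i : ℕ) : ℝ) / d i < (1 / 2 - η) * r}
  let kk : Bt d → Bt d → ℕ := fun e t => ∑ i, (vl e i - vl t i)
  have hkk : ∀ e t, kk e t ≤ K := fun e t => kk_le e _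
  let M : Lo × Fin n → Bt d → ℤ := fun tl e =>
    (∏ i, ((vl e i).choose (vl tl.1.1 i) : ℤ)) * a ^ (K - kk e tl.1.1) * (ρ (kk e tl.1.1)).coeff tl.2
  have hρ' : ∀ k j, |((ρ k).coeff j : ℝ)| ≤ (2 * (H : ℝ)) ^ k := by
    intro k j; exact_mod_cast hρ k j
  have hch0 : ∀ e t : Bt d, 0 ≤ ∏ i, ((vl e i).choose (vl t i) : ℝ) := fun e t =>
    Finset.prod_nonneg fun i _ => by positivity
  have hapow : ∀ e t : Bt d, |(a : ℝ)| ^ (K - kk e t) ≤ (H : ℝ) ^ (K - kk e t) := fun e t =>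
    pow_le_pow_left₀ (abs_nonneg _) haH _
  have hMb : ∀ i j, |(M i j : ℝ)| ≤ (4 * (H : ℝ)) ^ K := by
    rintro ⟨t, l⟩ e
    simp only [M]
    push_cast
    rw [abs_mul, abs_mul, abs_pow, abs_of_nonneg (hch0 e t.1)]
    calc _ ≤ 2 ^ K * (H : ℝ) ^ (K - kk e t.1) * (2 * (H : ℝ)) ^ (kk e t.1) := by
          gcongr
          · exact choose_prod e _
          · exact hρ' _ _
      _ = 2 ^ K * ((H : ℝ) ^ (K - kk e t.1) * (2 * (H : ℝ)) ^ (kk e t.1)) := by ring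
      _ ≤ 2 ^ K * (2 * (H : ℝ)) ^ K := by
          gcongr
          exact pow_mul_pow_le hH1' (by linarith) (hkk _ _)
      _ = _ := by rw [← mul_pow]; ring
  have hB1 : (1 : ℝ) ≤ (4 * (H : ℝ)) ^ K := one_le_pow₀ (by linarith)
  have hlow := low_count d hd η hη m hr hr0
  have hcardα : Fintype.card (Lo × Fin n) = Fintype.card Lo * n := by
    rw [Fintype.card_prod, Fintype.card_fin]
  have hLo0 : 0 < Fintype.card Lo := by
    rw [Fintype.card_pos_iff]
    refine ⟨⟨fun i => 0, ?_⟩⟩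
    simp
    apply mul_pos _ hr0'
    linarith
  obtain ⟨c, hc0, hker, hcb⟩ := siegel M _ hB1 hMb
    (by rw [hcardα]; exact Nat.mul_pos hLo0 hn1)
    (by
      rw [hcardα]
      refine le_trans ?_ hlow
      have : Fintype.card Lo * n ≤ Fintype.card Lo * m := Nat.mul_le_mul_left _ hnm
      calc 2 * (Fintype.card Lo * n) ≤ 2 * (Fintype.card Lo * m) := by omega
        _ = 2 * m * Fintype.card Lo := by ring)
  have hcb' : ∀ e, |(c e : ℝ)| ≤ (8 * (H : ℝ)) ^ K := by
    intro e
    refine (hcb e).trans ?_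
    calc _ ≤ 2 ^ K * (4 * (H : ℝ)) ^ K := by gcongr; exact card_Bt d
      _ = _ := by rw [← mul_pow]; ring
  -- the translate coefficients
  have hs : ∀ t : Bt d, sco (fun e => (c e : ℝ)) (fun _ => ξ) (vl t)
      = ∑ e, (c e : ℝ) * ((∏ i, ((vl e i).choose (vl t i) : ℝ)) * ξ ^ (kk e t)) := by
    intro t
    rw [sco]
    refine Finset.sum_congr rfl fun e _ => ?_
    rw [Finset.prod_mul_distrib, Finset.prod_pow_eq_pow_sum]
  refine ⟨c, hc0, ?_, ?_⟩
  · intro t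
    rw [hs]
    refine (Finset.abs_sum_le_sum_abs _ _).trans ?_
    have hterm : ∀ e : Bt d, |(c e : ℝ) * ((∏ i, ((vl e i).choose (vl t i) : ℝ)) * ξ ^ (kk e t))|
        ≤ (8 * (H : ℝ)) ^ K * (2 ^ K * (1 + |ξ|) ^ K) := by
      intro e
      rw [abs_mul, abs_mul, abs_pow, abs_of_nonneg (hch0 e t)]
      have h1 : |ξ| ^ (kk e t) ≤ (1 + |ξ|) ^ K :=
        (pow_le_pow_left₀ hxi (by linarith) _).trans (pow_le_pow_right₀ (by linarith) (hkk _ _))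
      gcongr
      · exact hcb' e
      · exact choose_prod e _
    refine (Finset.sum_le_sum fun e _ => hterm e).trans ?_
    rw [Finset.sum_const, Finset.card_univ, nsmul_eq_mul]
    calc _ ≤ 2 ^ K * ((8 * (H : ℝ)) ^ K * (2 ^ K * (1 + |ξ|) ^ K)) := by gcongr; exact card_Bt d
      _ = (32 * (H : ℝ) * (1 + |ξ|)) ^ K := by rw [← mul_pow, ← mul_pow, ← mul_pow]; ring
      _ ≤ _ := by
        apply pow_le_pow_left₀ (by positivity)
        have : (H : ℝ) ≤ (H : ℝ) ^ 2 := by nlinarith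
        gcongr
        · norm_num
  · intro t ht
    have hrow : ∀ l : ℕ, l < n → ∑ e, (c e : ℝ) * ((∏ i, ((vl e i).choose (vl t i) : ℝ)) *
        ((a : ℝ) ^ (K - kk e t) * ((ρ (kk e t)).coeff l : ℝ))) = 0 := by
      intro l hl
      have := hker (⟨t, ht⟩, ⟨l, hl⟩)
      have h2 : ((∑ e, M (⟨t, ht⟩, ⟨l, hl⟩) e * c e : ℤ) : ℝ) = 0 := by rw [this]; simp
      rw [← h2]
      push_cast
      refine Finset.sum_congr rfl fun e _ => ?_
      simp only [M]
      push_cast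
      ring
    have hev : ∀ k, (a : ℝ) ^ k * ξ ^ k = aeval ξ (g k) * aeval ξ F
        + ∑ l ∈ Finset.range n, ((ρ k).coeff l : ℝ) * ξ ^ l := by
      intro k
      have h1 := congrArg (aeval ξ) (hdiv k)
      have h2 : aeval ξ (ρ k) = ∑ l ∈ Finset.range n, ((ρ k).coeff l : ℝ) * ξ ^ l := by
        have h3 : (ρ k).natDegree < n := by
          by_contra hcon
          push Not at hcon
          have h4 := hdeg k _ hcon
          have h5 : ρ k = 0 := leadingCoeff_eq_zero.1 h4
          rw [h5] at hcon; simp at hcon; omega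
        rw [aeval_eq_sum_range' h3]
        refine Finset.sum_congr rfl fun l _ => ?_
        rw [zsmul_eq_mul]
      rw [← h2]
      simpa using h1
    have hkey : (a : ℝ) ^ K * sco (fun e => (c e : ℝ)) (fun _ => ξ) (vl t)
        = aeval ξ F * ∑ e, (c e : ℝ) * ((∏ i, ((vl e i).choose (vl t i) : ℝ)) *
        ((a : ℝ) ^ (K - kk e t) * aeval ξ (g (kk e t)))) := by
      have h1 : ∑ e, (c e : ℝ) * ((∏ i, ((vl e i).choose (vl t i) : ℝ)) *
        ((a : ℝ) ^ (K - kk e t) * ∑ l ∈ Finset.range n, ((ρ (kk e t)).coeff l : ℝ) * ξ ^ l)) = 0 := by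
        have h2 : ∀ e : Bt d, (c e : ℝ) * ((∏ i, ((vl e i).choose (vl t i) : ℝ)) *
          ((a : ℝ) ^ (K - kk e t) * ∑ l ∈ Finset.range n, ((ρ (kk e t)).coeff l : ℝ) * ξ ^ l))
          = ∑ l ∈ Finset.range n, ((c e : ℝ) * ((∏ i, ((vl e i).choose (vl t i) : ℝ)) *
        ((a : ℝ) ^ (K - kk e t) * ((ρ (kk e t)).coeff l : ℝ)))) * ξ ^ l := by
          intro e
          rw [Finset.mul_sum, Finset.mul_sum, Finset.mul_sum]
          refine Finset.sum_congr rfl fun l _ => ?_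
          ring
        simp only [h2]
        rw [Finset.sum_comm]
        refine Finset.sum_eq_zero fun l hl => ?_
        rw [← Finset.sum_mul, hrow l (Finset.mem_range.1 hl), zero_mul]
      rw [hs, Finset.mul_sum, Finset.mul_sum]
      refine Eq.trans ?_ (add_zero _)
      rw [← h1, ← Finset.sum_add_distrib]
      refine Finset.sum_congr rfl fun e _ => ?_
      have h3 : (a : ℝ) ^ K = (a : ℝ) ^ (K - kk e t) * (a : ℝ) ^ (kk e t) := by
        rw [← pow_add]; congr 1; have := hkk e t; omega
      have h4 := hev (kk e t)
      rw [h3]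
      linear_combination ((c e : ℝ) * (∏ i, ((vl e i).choose (vl t i) : ℝ)) * (a : ℝ) ^ (K - kk e t)) * h4
    have hsum : |∑ e, (c e : ℝ) * ((∏ i, ((vl e i).choose (vl t i) : ℝ)) *
        ((a : ℝ) ^ (K - kk e t) * aeval ξ (g (kk e t))))| ≤ (128 * (H : ℝ) ^ 2 * (1 + |ξ|)) ^ K := by
      refine (Finset.abs_sum_le_sum_abs _ _).trans ?_
      have hterm : ∀ e : Bt d, |(c e : ℝ) * ((∏ i, ((vl e i).choose (vl t i) : ℝ)) *
        ((a : ℝ) ^ (K - kk e t) * aeval ξ (g (kk e t))))|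
          ≤ (8 * (H : ℝ)) ^ K * (2 ^ K * (4 * (H : ℝ) * (1 + |ξ|)) ^ K) := by
        intro e
        rw [abs_mul, abs_mul, abs_mul, abs_pow, abs_of_nonneg (hch0 e t)]
        have h1 : |(a : ℝ)| ^ (K - kk e t) * |aeval ξ (g (kk e t))| ≤ (4 * (H : ℝ) * (1 + |ξ|)) ^ K := by
          refine le_trans (mul_le_mul (hapow e t) (hg _) (abs_nonneg _) (by positivity)) ?_
          exact pow_mul_pow_le hH1' (by nlinarith) (hkk _ _)
        gcongr
        · exact hcb' e
        · exact choose_prod e _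
      refine (Finset.sum_le_sum fun e _ => hterm e).trans ?_
      rw [Finset.sum_const, Finset.card_univ, nsmul_eq_mul]
      calc _ ≤ 2 ^ K * ((8 * (H : ℝ)) ^ K * (2 ^ K * (4 * (H : ℝ) * (1 + |ξ|)) ^ K)) := by
            gcongr; exact card_Bt d
        _ = _ := by rw [← mul_pow, ← mul_pow, ← mul_pow]; ring
    have hfin : |(a : ℝ)| ^ K * |sco (fun e => (c e : ℝ)) (fun _ => ξ) (vl t)|
        ≤ |aeval ξ F| * (128 * (H : ℝ) ^ 2 * (1 + |ξ|)) ^ K := by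
      rw [← abs_pow, ← abs_mul, hkey, abs_mul]
      exact mul_le_mul_of_nonneg_left hsum (abs_nonneg _)
    refine le_trans ?_ hfin
    exact le_mul_of_one_le_left (abs_nonneg _) (one_le_pow₀ ha1)

end Bak

namespace Bak

lemma sco_lower {r : ℕ} {d : Fin r → ℕ} (c : Bt d → ℤ) (p : Fin r → ℤ) (q : Fin r → ℕ)
    (hq : ∀ i, 0 < q i) (e : Fin r → ℕ)
    (h : sco (fun e => (c e : ℝ)) (fun i => (p i : ℝ) / q i) e ≠ 0) :
    1 ≤ |sco (fun e => (c e : ℝ)) (fun i => (p i : ℝ) / q i) e| * ∏ i, (q i : ℝ) ^ (d i) := by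
  have hint : sco (fun e => (c e : ℝ)) (fun i => (p i : ℝ) / q i) e * ∏ i, (q i : ℝ) ^ (d i)
      = ((∑ v : Bt d, c v * ∏ i, (((vl v i).choose (e i) : ℤ) * (p i) ^ (vl v i - e i) *
          (q i : ℤ) ^ (d i - (vl v i - e i))) : ℤ) : ℝ) := by
    rw [sco, Finset.sum_mul]
    push_cast
    refine Finset.sum_congr rfl fun v _ => ?_
    rw [mul_assoc, ← Finset.prod_mul_distrib]
    congr 1
    refine Finset.prod_congr rfl fun i _ => ?_
    have hle : vl v i - e i ≤ d i := (Nat.sub_le _ _).trans (vl_le v i)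
    have h1 : (q i : ℝ) ^ (d i) = (q i : ℝ) ^ (vl v i - e i) * (q i : ℝ) ^ (d i - (vl v i - e i)) := by
      rw [← pow_add]; congr 1; omega
    have h2 : (q i : ℝ) ^ (vl v i - e i) ≠ 0 := pow_ne_zero _ (by exact_mod_cast (hq i).ne')
    rw [h1, div_pow]
    field_simp
  have hQ : 0 < ∏ i, (q i : ℝ) ^ (d i) :=
    Finset.prod_pos fun i _ => pow_pos (by exact_mod_cast hq i) _
  rw [← abs_of_pos hQ, ← abs_mul, hint]
  have hne : (∑ v : Bt d, c v * ∏ i, (((vl v i).choose (e i) : ℤ) * (p i) ^ (vl v i - e i) *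
          (q i : ℤ) ^ (d i - (vl v i - e i))) : ℤ) ≠ 0 := by
    intro h0
    rw [h0] at hint
    apply h
    have : sco (fun e => (c e : ℝ)) (fun i => (p i : ℝ) / q i) e * ∏ i, (q i : ℝ) ^ (d i) = 0 := by
      rw [hint]; simp
    exact (mul_eq_zero.1 this).resolve_right hQ.ne'
  exact_mod_cast Int.one_le_abs hne

lemma sco_upper {r : ℕ} (hr : 1 ≤ r) {d : Fin r → ℕ} (hd : ∀ i, 0 < d i) (b : Bt d → ℝ) (z : Fin r → ℝ)
    (ℓ : Fin r → ℝ) (hℓ : ∀ i, 0 ≤ ℓ i) (κ : ℝ) (hκ : 0 ≤ κ)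
    (hz : ∀ i, |z i| ≤ Real.exp (-κ * ℓ i))
    (lam η : ℝ) (hη : 0 < η) (hlam0 : 0 ≤ lam) (hlam : ∀ i, lam ≤ d i * ℓ i)
    (G f : ℝ) (hG : 0 ≤ G) (hf : 0 ≤ f)
    (hb : ∀ t, |b t| ≤ G)
    (hlow : ∀ t : Bt d, ∑ i, ((t i : ℕ) : ℝ) / d i < (1 / 2 - η) * r → |b t| ≤ f * G)
    (e : Fin r → ℕ) (he : ∑ i, ((e i : ℕ) : ℝ) / d i ≤ η) :
    |sco b z e| ≤ (4 ^ (∑ i, d i) * G) * (f + Real.exp (-κ * lam * ((1 / 2 - 2 * η) * r))) := by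
  have hr' : (1 : ℝ) ≤ r := by exact_mod_cast hr
  set E := Real.exp (-κ * lam * ((1 / 2 - 2 * η) * r)) with hE
  have hE0 : 0 < E := Real.exp_pos _
  rw [sco]
  refine (Finset.abs_sum_le_sum_abs _ _).trans ?_
  have hterm : ∀ t : Bt d, |b t * ∏ i, ((vl t i).choose (e i) : ℝ) * z i ^ (vl t i - e i)|
      ≤ 2 ^ (∑ i, d i) * G * (f + E) := by
    intro t
    by_cases hte : ∀ i, e i ≤ vl t i
    swap
    · push Not at hte
      obtain ⟨i, hi⟩ := hte
      have : ∏ i, ((vl t i).choose (e i) : ℝ) * z i ^ (vl t i - e i) = 0 := by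
        apply Finset.prod_eq_zero (Finset.mem_univ i)
        rw [Nat.choose_eq_zero_of_lt hi]; simp
      rw [this]; simp; positivity
    have hch0 : 0 ≤ ∏ i, ((vl t i).choose (e i) : ℝ) := Finset.prod_nonneg fun i _ => by positivity
    rw [Finset.prod_mul_distrib, abs_mul, abs_mul, abs_of_nonneg hch0]
    have hz1 : |∏ i, z i ^ (vl t i - e i)| ≤
        Real.exp (-κ * ∑ i, ℓ i * ((vl t i : ℝ) - e i)) := by
      rw [Finset.abs_prod, Finset.mul_sum, Real.exp_sum]
      refine Finset.prod_le_prod (fun i _ => abs_nonneg _) fun i _ => ?_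
      rw [abs_pow]
      refine (pow_le_pow_left₀ (abs_nonneg _) (hz i) _).trans ?_
      rw [← Real.exp_nat_mul, Nat.cast_sub (hte i)]
      exact le_of_eq (by congr 1; ring)
    have hsum : lam * (∑ i, ((t i : ℕ) : ℝ) / d i - η) ≤ ∑ i, ℓ i * ((vl t i : ℝ) - e i) := by
      calc lam * (∑ i, ((t i : ℕ) : ℝ) / d i - η)
          ≤ lam * (∑ i, ((t i : ℕ) : ℝ) / d i - ∑ i, ((e i : ℕ) : ℝ) / d i) := by gcongr
        _ = ∑ i, lam * ((((t i : ℕ) : ℝ) - e i) / d i) := by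
          rw [← Finset.sum_sub_distrib, Finset.mul_sum]
          refine Finset.sum_congr rfl fun i _ => ?_
          ring
        _ ≤ _ := by
          refine Finset.sum_le_sum fun i _ => ?_
          have hdi : (0 : ℝ) < d i := by exact_mod_cast hd i
          have h1 : (0 : ℝ) ≤ ((t i : ℕ) : ℝ) - e i := by
            rw [sub_nonneg]; exact_mod_cast hte i
          calc lam * ((((t i : ℕ) : ℝ) - e i) / d i) ≤ (d i * ℓ i) * ((((t i : ℕ) : ℝ) - e i) / d i) :=
                mul_le_mul_of_nonneg_right (hlam i) (by positivity)
            _ = ℓ i * ((vl t i : ℝ) - e i) := by simp only [vl]; field_simp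
    have hch := choose_prod t e
    by_cases hl : ∑ i, ((t i : ℕ) : ℝ) / d i < (1 / 2 - η) * r
    · have h1 : |∏ i, z i ^ (vl t i - e i)| ≤ 1 := by
        refine hz1.trans (Real.exp_le_one_iff.2 ?_)
        have : 0 ≤ ∑ i, ℓ i * ((vl t i : ℝ) - e i) := Finset.sum_nonneg fun i _ =>
          mul_nonneg (hℓ i) (by rw [sub_nonneg]; exact_mod_cast hte i)
        nlinarith
      calc _ ≤ (f * G) * (2 ^ (∑ i, d i) * 1) := by
            gcongr
            exact hlow t hl
        _ = 2 ^ (∑ i, d i) * G * f := by ring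
        _ ≤ _ := by gcongr; linarith
    · push Not at hl
      have h1 : |∏ i, z i ^ (vl t i - e i)| ≤ E := by
        refine hz1.trans (Real.exp_le_exp.2 ?_)
        have h2 : (1 / 2 - 2 * η) * r ≤ ∑ i, ((t i : ℕ) : ℝ) / d i - η := by nlinarith
        have h3 : lam * ((1 / 2 - 2 * η) * r) ≤ ∑ i, ℓ i * ((vl t i : ℝ) - e i) :=
          (mul_le_mul_of_nonneg_left h2 hlam0).trans hsum
        nlinarith
      calc _ ≤ G * (2 ^ (∑ i, d i) * E) := by
            gcongr
            exact hb t
        _ = 2 ^ (∑ i, d i) * G * E := by ring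
        _ ≤ _ := by gcongr; linarith
  refine (Finset.sum_le_sum fun t _ => hterm t).trans ?_
  rw [Finset.sum_const, Finset.card_univ, nsmul_eq_mul]
  calc _ ≤ 2 ^ (∑ i, d i) * (2 ^ (∑ i, d i) * G * (f + E)) := by gcongr; exact card_Bt d
    _ = (2 ^ (∑ i, d i) * 2 ^ (∑ i, d i)) * G * (f + E) := by ring
    _ = _ := by rw [← mul_pow]; norm_num

/-- the core inequality -/
theorem core (F : ℤ[X]) (n m : ℕ) (hn : F.natDegree = n) (hn1 : 1 ≤ n) (hnm : n ≤ m)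
    (H : ℕ) (hH1 : 1 ≤ H) (hH : ∀ j, |F.coeff j| ≤ (H : ℤ)) (ξ : ℝ) {r : ℕ} (hr0 : 1 ≤ r)
    (η ε : ℝ) (hη : 0 < η) (hη2 : η < 1 / 2) (hε : 0 < ε)
    (hr : (m : ℝ) / (2 * η ^ 2) ≤ r) (M : ℕ) (ρ : ℝ)
    (hgeo : ∀ d : Fin r → ℕ, (∀ i, 0 < d i) → (∀ i j, i < j → (d j : ℝ) ≤ ρ * d i) →
      ∀ (S : Finset ℕ) (s : ℕ → Fin r → ℝ), (∀ i, Set.InjOn (fun k => s k i) S) → M ≤ S.card →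
      ∀ P : A r, P ≠ 0 → P ∈ Box d → ∃ k ∈ S, ∃ e, (shift (s k) P).coeff e ≠ 0 ∧ wt d e ≤ η)
    (d : Fin r → ℕ) (hd : ∀ i, 0 < d i) (hsep : ∀ i j, i < j → (d j : ℝ) ≤ ρ * d i)
    (S : Finset ℕ) (hM : M ≤ S.card) (p : ℕ → Fin r → ℤ) (q : ℕ → Fin r → ℕ)
    (hinj : ∀ i, Set.InjOn (fun k => (p k i : ℝ) / q k i) S) (hq : ∀ k i, 1 ≤ q k i)
    (happ : ∀ k i, |ξ - (p k i : ℝ) / q k i| ≤ (q k i : ℝ) ^ (-(2 + ε)))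
    (lam : ℕ → ℝ) (hlam : ∀ k ∈ S, 0 ≤ lam k ∧ ∀ i, lam k ≤ d i * Real.log (q k i) ∧
        d i * Real.log (q k i) ≤ (1 + η) * lam k) :
    ∃ k ∈ S, Real.exp (-((1 + η) * lam k * r)) ≤ (512 * (H : ℝ) ^ 2 * (1 + |ξ|)) ^ (∑ i, d i) *
      (|aeval ξ F| + Real.exp (-(2 + ε) * lam k * ((1 / 2 - 2 * η) * r))) := by
  obtain ⟨c, hc0, hc1, hc2⟩ := aux_poly F n m hn hn1 hnm H hH1 hH ξ (by omega) d hd η hη hη2 hr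
  set c' : Bt d → ℝ := fun e => (c e : ℝ) with hc'
  have hP0 : poly c' ≠ 0 := by
    intro h
    apply hc0
    funext e
    have := coeff_poly c' e
    rw [h, MvPolynomial.coeff_zero] at this
    have h2 : (c e : ℝ) = 0 := this.symm
    exact_mod_cast h2
  obtain ⟨k, hk, e, he, hwt⟩ := hgeo d hd hsep S (fun k i => (p k i : ℝ) / q k i) hinj hM (poly c') hP0
    (poly_Box c')
  refine ⟨k, hk, ?_⟩
  obtain ⟨hl0, hl⟩ := hlam k hk
  have hee : e = fs (fun i => e i) := by ext i; rfl
  rw [hee, coeff_shift_poly] at he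
  have hlo := sco_lower c (p k) (q k) (fun i => hq k i) _ he
  have hqpos : ∀ i, (0 : ℝ) < q k i := fun i => by exact_mod_cast hq k i
  have hprod : ∏ i, (q k i : ℝ) ^ (d i) ≤ Real.exp ((1 + η) * lam k * r) := by
    calc ∏ i, (q k i : ℝ) ^ (d i) ≤ ∏ i : Fin r, Real.exp ((1 + η) * lam k) := by
          refine Finset.prod_le_prod (fun i _ => by positivity) fun i _ => ?_
          rw [← Real.exp_log (hqpos i), ← Real.exp_nat_mul]
          exact Real.exp_le_exp.2 (hl i).2
      _ = _ := by
          rw [Finset.prod_const, Finset.card_univ, Fintype.card_fin, ← Real.exp_nat_mul]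
          congr 1; ring
  have hup := sco_upper hr0 hd (fun t => sco c' (fun _ => ξ) (vl t))
    (fun i => (p k i : ℝ) / q k i - ξ) (fun i => Real.log (q k i))
    (fun i => Real.log_nonneg (by exact_mod_cast hq k i)) (2 + ε) (by linarith)
    (fun i => by
      rw [abs_sub_comm]
      refine (happ k i).trans (le_of_eq ?_)
      rw [Real.rpow_def_of_pos (hqpos i)]; congr 1; ring) (lam k) η hη hl0 (fun i => (hl i).1)
    ((128 * (H : ℝ) ^ 2 * (1 + |ξ|)) ^ (∑ i, d i)) |aeval ξ F| (by positivity) (abs_nonneg _)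
    hc1 hc2 (fun i => e i) hwt
  rw [← sco_comp] at hup
  have h1 : (4 : ℝ) ^ (∑ i, d i) * (128 * (H : ℝ) ^ 2 * (1 + |ξ|)) ^ (∑ i, d i)
      = (512 * (H : ℝ) ^ 2 * (1 + |ξ|)) ^ (∑ i, d i) := by rw [← mul_pow]; ring
  rw [h1] at hup
  refine le_trans ?_ hup
  rw [Real.exp_neg, inv_le_iff_one_le_mul₀ (Real.exp_pos _)]
  exact hlo.trans (mul_le_mul_of_nonneg_left hprod (abs_nonneg _))

end Bak

namespace Bak

theorem tuples (ℓ : ℕ → ℝ) (C L0 : ℝ) (hC : 1 ≤ C) (hL0 : 0 < L0)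
    (hsup : ∀ L, L0 ≤ L → ∃ n, L ≤ ℓ n ∧ ℓ n ≤ C * L) (r : ℕ) (η : ℝ) (hη : 0 < η) (hη1 : η ≤ 1)
    (M : ℕ) (ρ : ℝ) (hρ : 0 < ρ) :
    ∃ D B : ℝ, 1 ≤ D ∧ 1 ≤ B ∧ ∀ Λ, L0 ≤ Λ → ∃ d : Fin r → ℕ, (∀ i, 0 < d i) ∧
      (∀ i j, i < j → (d j : ℝ) ≤ ρ * d i) ∧ (∀ i, (d i : ℝ) ≤ 2 * D) ∧
      ∃ S : Finset ℕ, M ≤ S.card ∧ ∃ nn : ℕ → Fin r → ℕ, ∃ lam : ℕ → ℝ,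
        (∀ i, Set.InjOn (fun k => nn k i) S) ∧ ∀ k ∈ S, D * Λ ≤ lam k ∧ lam k ≤ D * Λ * B ∧
          ∀ i, lam k ≤ d i * ℓ (nn k i) ∧ d i * ℓ (nn k i) ≤ (1 + η) * lam k := by
  classical
  set η' := η / 3 with hη'
  have hη'0 : 0 < η' := by positivity
  have hη'1 : η' ≤ 1 / 3 := by rw [hη']; linarith
  have hη'2 : (1 + η') * (1 + η') ≤ 1 + η := by rw [hη']; nlinarith
  set C' := C + 2 with hC'
  set R := max (2 * C' / ρ) 1 with hR
  have hR1 : 1 ≤ R := le_max_right _ _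
  have hRρ : 2 * C' ≤ ρ * R := by
    have : 2 * C' / ρ ≤ R := le_max_left _ _
    rw [div_le_iff₀ hρ] at this; linarith
  set N := ⌈C / η'⌉₊ with hN
  set Tm := M * (N + 1) ^ r with hTm
  set D := R ^ r * C' / η' with hD
  have hRr : 1 ≤ R ^ r := one_le_pow₀ hR1
  have hD1 : 1 ≤ D := by
    rw [hD, le_div_iff₀ hη'0]
    nlinarith
  refine ⟨D, (2 * C) ^ Tm, hD1, one_le_pow₀ (by linarith), ?_⟩
  intro Λ hΛ
  have hΛ0 : 0 < Λ := by linarith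
  let L : ℕ → Fin r → ℝ := fun T i => Λ * (2 * C) ^ T * R ^ (i : ℕ)
  have hLΛ : ∀ T i, Λ ≤ L T i := by
    intro T i
    have h1 : 1 ≤ (2 * C) ^ T := one_le_pow₀ (by linarith)
    have h2 : 1 ≤ R ^ (i : ℕ) := one_le_pow₀ hR1
    calc Λ = Λ * 1 * 1 := by ring
      _ ≤ _ := by simp only [L]; gcongr
  have hLpos : ∀ T i, 0 < L T i := fun T i => lt_of_lt_of_le hΛ0 (hLΛ T i)
  choose nn hnn1 hnn2 using fun T i => hsup (L T i) (hΛ.trans (hLΛ T i))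
  let x : ℕ → Fin r → ℝ := fun T i => (ℓ (nn T i) / L T i - 1) / η'
  have hx0 : ∀ T i, 0 ≤ x T i := by
    intro T i
    have : 1 ≤ ℓ (nn T i) / L T i := by rw [le_div_iff₀ (hLpos T i)]; linarith [hnn1 T i]
    exact div_nonneg (by linarith) hη'0.le
  have hxN : ∀ T i, ⌊x T i⌋₊ < N + 1 := by
    intro T i
    have h1 : ℓ (nn T i) / L T i ≤ C := by rw [div_le_iff₀ (hLpos T i)]; exact hnn2 T i
    have h2 : x T i ≤ C / η' := by
      simp only [x]; gcongr; linarith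
    have h3 : x T i ≤ N := h2.trans (Nat.le_ceil _)
    have h4 : ⌊x T i⌋₊ ≤ N := Nat.floor_le_of_le h3
    omega
  let col : ℕ → (Fin r → Fin (N + 1)) := fun T i => ⟨⌊x T i⌋₊, hxN T i⟩
  obtain ⟨κ, -, hκ⟩ := Finset.exists_le_card_fiber_of_mul_le_card_of_maps_to
    (s := Finset.range Tm) (t := (Finset.univ : Finset (Fin r → Fin (N + 1)))) (f := col) (n := M)
    (fun _ _ => Finset.mem_univ _) Finset.univ_nonempty (by simp [hTm, mul_comm])
  let v : Fin r → ℝ := fun i => 1 + (κ i : ℕ) * η'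
  have hv1 : ∀ i, 1 ≤ v i := fun i => by
    have : 0 ≤ ((κ i : ℕ) : ℝ) * η' := by positivity
    simp only [v]; linarith
  have hvC : ∀ i, v i ≤ C' := fun i => by
    have h1 : ((κ i : ℕ) : ℝ) ≤ N := by have := (κ i).2; exact_mod_cast (by omega)
    have h2 : (N : ℝ) < C / η' + 1 := Nat.ceil_lt_add_one (by positivity)
    have h3 : ((κ i : ℕ) : ℝ) * η' ≤ (C / η' + 1) * η' := by gcongr; linarith
    have h4 : (C / η' + 1) * η' = C + η' := by field_simp
    simp only [v]; linarith
  let y : Fin r → ℝ := fun i => D / (R ^ (i : ℕ) * v i)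
  have hRi0 : ∀ i : Fin r, 0 < R ^ (i : ℕ) := fun i => by positivity
  have hRv : ∀ i : Fin r, 0 < R ^ (i : ℕ) * v i := fun i => mul_pos (hRi0 i) (by linarith [hv1 i])
  have hy1 : ∀ i, 1 / η' ≤ y i := by
    intro i
    simp only [y]
    rw [div_le_div_iff₀ hη'0 (hRv i)]
    have : D * η' = R ^ r * C' := by rw [hD]; field_simp
    rw [this, one_mul]
    have h1 : R ^ (i : ℕ) ≤ R ^ r := pow_le_pow_right₀ hR1 i.2.le
    exact mul_le_mul h1 (hvC i) (by linarith [hv1 i]) (by linarith)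
  have hy1' : ∀ i, 1 ≤ η' * y i := by
    intro i
    have := hy1 i
    rw [div_le_iff₀ hη'0] at this; linarith
  have hy0 : ∀ i, 0 < y i := fun i => by have := hy1' i; by_contra h; nlinarith
  have hyD : ∀ i, y i ≤ D := by
    intro i
    simp only [y]
    apply div_le_self (by linarith)
    have : 1 ≤ R ^ (i : ℕ) := one_le_pow₀ hR1
    nlinarith [hv1 i]
  have hdl : ∀ i, y i ≤ (⌈y i⌉₊ : ℝ) := fun i => Nat.le_ceil _
  have hdu : ∀ i, (⌈y i⌉₊ : ℝ) ≤ (1 + η') * y i := fun i => by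
    have := Nat.ceil_lt_add_one (hy0 i).le
    have := hy1' i
    linarith
  refine ⟨fun i => ⌈y i⌉₊, fun i => Nat.ceil_pos.2 (hy0 i), ?_, ?_, _, hκ, nn,
    fun T => D * Λ * (2 * C) ^ T, ?_, ?_⟩
  · intro i j hij
    have h1 : y j * R ≤ C' * y i := by
      have e1 : y j * (R ^ (j : ℕ) * v j) = D := div_mul_cancel₀ D (hRv j).ne'
      have e2 : y i * (R ^ (i : ℕ) * v i) = D := div_mul_cancel₀ D (hRv i).ne'
      have e3 : R ^ (i : ℕ) * R ≤ R ^ (j : ℕ) := by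
        rw [← pow_succ]; exact pow_le_pow_right₀ hR1 hij
      have e4 : R ^ (i : ℕ) * (y j * R) ≤ R ^ (i : ℕ) * (C' * y i) := by
        calc R ^ (i : ℕ) * (y j * R) = y j * (R ^ (i : ℕ) * R) * 1 := by ring
          _ ≤ y j * (R ^ (j : ℕ)) * v j := by
            have := (hy0 j).le
            have := hv1 j
            gcongr
          _ = D := by rw [← e1]; ring
          _ = R ^ (i : ℕ) * (v i * y i) := by rw [← e2]; ring
          _ ≤ _ := by
            have := (hy0 i).le
            have := hvC i
            gcongr
      exact le_of_mul_le_mul_left e4 (hRi0 i)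
    have h2 : (⌈y j⌉₊ : ℝ) ≤ 2 * y j := (hdu j).trans (by nlinarith [hy0 j])
    have h3 : 2 * y j * R ≤ ρ * y i * R := by
      calc 2 * y j * R = 2 * (y j * R) := by ring
        _ ≤ 2 * (C' * y i) := by linarith
        _ = (2 * C') * y i := by ring
        _ ≤ (ρ * R) * y i := by have := (hy0 i).le; gcongr
        _ = _ := by ring
    have h4 : 2 * y j ≤ ρ * y i := le_of_mul_le_mul_right h3 (by linarith)
    calc (⌈y j⌉₊ : ℝ) ≤ ρ * y i := h2.trans h4
      _ ≤ ρ * ⌈y i⌉₊ := by gcongr; exact hdl i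
  · intro i
    exact (hdu i).trans (by nlinarith [hy0 i, hyD i])
  · intro i
    have key : ∀ T T', T < T' → nn T i ≠ nn T' i := by
      intro T T' hT h
      have h1 := hnn2 T i
      have h2 := hnn1 T' i
      rw [← h] at h2
      have h3 : C * L T i < L T' i := by
        have hp : 0 < L T i := hLpos T i
        have h4 : 2 * C * L T i ≤ L T' i := by
          have h5 : (2 * C) ^ (T + 1) ≤ (2 * C) ^ T' := pow_le_pow_right₀ (by linarith) hT
          simp only [L]
          calc 2 * C * (Λ * (2 * C) ^ T * R ^ (i : ℕ)) = Λ * (2 * C) ^ (T + 1) * R ^ (i : ℕ) := by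
                rw [pow_succ]; ring
            _ ≤ _ := by gcongr
        nlinarith
      linarith
    intro T _ T' _ h
    rcases lt_trichotomy T T' with h1 | h1 | h1
    · exact absurd h (key T T' h1)
    · exact h1
    · exact absurd h.symm (key T' T h1)
  · intro T hT
    rw [Finset.mem_filter, Finset.mem_range] at hT
    obtain ⟨hT1, hT2⟩ := hT
    have hDΛ : 0 < D * Λ := by positivity
    refine ⟨le_mul_of_one_le_right hDΛ.le (one_le_pow₀ (by linarith)),
      mul_le_mul_of_nonneg_left (pow_le_pow_right₀ (by linarith) hT1.le) hDΛ.le, ?_⟩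
    intro i
    have hk : (κ i : ℕ) = ⌊x T i⌋₊ := by rw [← hT2]
    have hf1 : ((κ i : ℕ) : ℝ) ≤ x T i := by rw [hk]; exact Nat.floor_le (hx0 T i)
    have hf2 : x T i ≤ (κ i : ℕ) + 1 := by rw [hk]; exact (Nat.lt_floor_add_one _).le
    have hℓx : ℓ (nn T i) = L T i * (1 + x T i * η') := by
      have := (hLpos T i).ne'
      simp only [x]; field_simp; ring
    have hlx : L T i * v i * y i = D * Λ * (2 * C) ^ T := by
      have e2 : y i * (R ^ (i : ℕ) * v i) = D := div_mul_cancel₀ D (hRv i).ne'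
      rw [← e2]; simp only [L]; ring
    have hl1 : L T i * v i ≤ ℓ (nn T i) := by
      rw [hℓx]
      simp only [v]
      have := hLpos T i
      gcongr
    have hl2 : ℓ (nn T i) ≤ L T i * ((1 + η') * v i) := by
      rw [hℓx]
      have := hLpos T i
      gcongr
      have h1 := hv1 i
      have h2 : x T i * η' ≤ ((κ i : ℕ) + 1) * η' := by gcongr
      have h3 : v i = 1 + (κ i : ℕ) * η' := rfl
      nlinarith
    have hLv : 0 < L T i * v i := mul_pos (hLpos T i) (by linarith [hv1 i])
    constructor
    · calc D * Λ * (2 * C) ^ T = y i * (L T i * v i) := by rw [← hlx]; ring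
        _ ≤ ⌈y i⌉₊ * ℓ (nn T i) := by
          have := hy0 i
          gcongr
          exact hdl i
    · calc (⌈y i⌉₊ : ℝ) * ℓ (nn T i) ≤ ((1 + η') * y i) * (L T i * ((1 + η') * v i)) := by
            have := hy0 i
            have := hdu i
            have : 0 ≤ ℓ (nn T i) := hLv.le.trans hl1
            gcongr
        _ = ((1 + η') * (1 + η')) * (L T i * v i * y i) := by ring
        _ = ((1 + η') * (1 + η')) * (D * Λ * (2 * C) ^ T) := by rw [hlx]
        _ ≤ _ := by gcongr

end Bak

namespace Bak

lemma supply (ξ : ℝ) (p : ℕ → ℤ) (q : ℕ → ℕ) (hq : ∀ n, 2 ≤ q n)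
    (hdist : ∀ m n, m ≠ n → (p m : ℝ) / (q m : ℝ) ≠ (p n : ℝ) / (q n : ℝ))
    (happ : ∀ n, |ξ - (p n : ℝ) / (q n : ℝ)| ≤ 1)
    (hgrowth : ∃ C : ℝ, ∀ᶠ n in Filter.atTop, Real.log (q (n + 1)) ≤ C * Real.log (q n)) :
    ∃ C L0 : ℝ, 1 ≤ C ∧ 0 < L0 ∧ ∀ L, L0 ≤ L → ∃ n, L ≤ Real.log (q n) ∧ Real.log (q n) ≤ C * L := by
  have hqpos : ∀ n, (0 : ℝ) < q n := fun n => by exact_mod_cast (by linarith [hq n] : 0 < q n)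
  have hfin : ∀ Q : ℕ, {n | q n ≤ Q}.Finite := by
    intro Q
    set Bd : ℤ := ⌈(|ξ| + 1) * Q⌉ with hBd
    have hinj : Set.InjOn (fun n => (p n, q n)) {n | q n ≤ Q} := by
      intro a _ b _ hab
      by_contra hne
      have h1 : p a = p b := congrArg Prod.fst hab
      have h2 : q a = q b := congrArg Prod.snd hab
      exact hdist a b hne (by rw [h1, h2])
    refine Set.Finite.of_finite_image (Set.Finite.subset
      ((Set.finite_Icc (-Bd) Bd).prod (Set.finite_Iic Q)) ?_) hinj
    rintro _ ⟨n, hn, rfl⟩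
    refine ⟨?_, hn⟩
    rw [Set.mem_Icc, ← abs_le]
    have h1 : |(p n : ℝ) / q n| ≤ |ξ| + 1 := by
      have h2 := abs_sub_abs_le_abs_sub ((p n : ℝ) / q n) ξ
      rw [abs_sub_comm] at h2
      linarith [happ n]
    have h3 : |(p n : ℝ)| ≤ (|ξ| + 1) * Q := by
      rw [abs_div, abs_of_pos (hqpos n), div_le_iff₀ (hqpos n)] at h1
      refine h1.trans ?_
      have : (q n : ℝ) ≤ Q := by exact_mod_cast hn
      have := abs_nonneg ξ
      gcongr
    have h4 := h3.trans (Int.le_ceil _)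
    exact_mod_cast h4
  obtain ⟨C, hC⟩ := hgrowth
  obtain ⟨N0, hN0⟩ := Filter.eventually_atTop.1 hC
  have hlog : ∀ n, 0 < Real.log (q n) := fun n => Real.log_pos (by exact_mod_cast hq n)
  refine ⟨max C 1, Real.log (q N0) + 1, le_max_right _ _, by linarith [hlog N0], ?_⟩
  intro L hL
  have hL0 : 0 < L := by linarith [hlog N0]
  have hex : ∃ k, L ≤ Real.log (q (N0 + k)) := by
    have h1 := (hfin ⌈Real.exp L⌉₊).union (Set.finite_Iio N0)
    obtain ⟨n, hn⟩ := h1.exists_notMem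
    simp only [Set.mem_union, Set.mem_setOf_eq, Set.mem_Iio, not_or, not_le, not_lt] at hn
    refine ⟨n - N0, ?_⟩
    rw [show N0 + (n - N0) = n by omega, Real.le_log_iff_exp_le (hqpos n)]
    refine (Nat.le_ceil _).trans ?_
    exact_mod_cast hn.1.le
  classical
  have hk := Nat.find_spec hex
  have hmin := fun j => Nat.find_min (H := hex) (m := j)
  set k := Nat.find hex with hkdef
  have hk0 : k ≠ 0 := by
    intro h
    rw [h] at hk
    simp at hk
    linarith
  obtain ⟨j, hj⟩ := Nat.exists_eq_succ_of_ne_zero hk0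
  have h1 := hmin j (by omega)
  push Not at h1
  refine ⟨N0 + k, hk, ?_⟩
  have h2 := hN0 (N0 + j) (by omega)
  rw [show N0 + j + 1 = N0 + k by omega] at h2
  refine h2.trans ?_
  have h3 := hlog (N0 + j)
  calc C * Real.log (q (N0 + j)) ≤ max C 1 * Real.log (q (N0 + j)) := by
        gcongr; exact le_max_left _ _
    _ ≤ max C 1 * L := by gcongr

lemma coeff_le_height (P : ℤ[X]) (j : ℕ) : |P.coeff j| ≤ (polyHeight P : ℤ) := by
  by_cases h : j ∈ P.support
  · have := Finset.le_sup (f := fun i => (P.coeff i).natAbs) h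
    rw [Int.abs_eq_natAbs]
    exact_mod_cast this
  · rw [notMem_support_iff.1 h]; simp

lemma finite_height (m H0 : ℕ) : {P : ℤ[X] | P.natDegree ≤ m ∧ polyHeight P ≤ H0}.Finite := by
  have hinj : Set.InjOn (fun (P : ℤ[X]) (i : Fin (m + 1)) => P.coeff i)
      {P : ℤ[X] | P.natDegree ≤ m ∧ polyHeight P ≤ H0} := by
    intro P hP Q hQ h
    ext i
    by_cases hi : i < m + 1
    · exact congrFun h ⟨i, hi⟩
    · rw [coeff_eq_zero_of_natDegree_lt (by have := hP.1; omega),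
        coeff_eq_zero_of_natDegree_lt (by have := hQ.1; omega)]
  refine Set.Finite.of_finite_image (Set.Finite.subset
    (Set.finite_Icc (fun _ => -(H0 : ℤ)) (fun _ => (H0 : ℤ))) ?_) hinj
  rintro _ ⟨P, hP, rfl⟩
  have h : ∀ j, |P.coeff j| ≤ (H0 : ℤ) := fun j =>
    (coeff_le_height P j).trans (by exact_mod_cast hP.2)
  exact ⟨fun i => (abs_le.1 (h i)).1, fun i => (abs_le.1 (h i)).2⟩

lemma final_ineq (η ε h D B lam r f W ω : ℝ) (hη : 0 < η) (hε1 : ε ≤ 1) (hηε : η = ε / 40)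
    (hh : 1 ≤ h) (hD : 1 ≤ D) (hr : 1 ≤ r)
    (hl1 : D * (h / η) ≤ lam) (hl2 : lam ≤ D * (h / η) * B)
    (hω : ω = 6 * D * r + 2 * r * D * B / η + 1) (hf0 : 0 ≤ f) (hf : f ≤ Real.exp (-ω * h))
    (hW : W ≤ Real.exp (6 * D * r * h)) (hW0 : 0 ≤ W) :
    W * (f + Real.exp (-(2 + ε) * lam * ((1 / 2 - 2 * η) * r))) < Real.exp (-((1 + η) * lam * r)) := by
  have hε : ε = 40 * η := by linarith
  have hηl : D * h ≤ η * lam := by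
    have := mul_le_mul_of_nonneg_left hl1 hη.le
    have e : η * (D * (h / η)) = D * h := by field_simp
    linarith
  have hDh : 1 ≤ D * h := by nlinarith
  have hlam : 0 < lam := by by_contra hc; nlinarith
  have hlr : D * r * h ≤ η * lam * r := by nlinarith
  have h1 : 1 ≤ η * lam * r := by nlinarith
  have he1 : Real.exp (-1) < 1 / 2 := by
    have := Real.exp_neg_one_lt_d9
    linarith
  set E := Real.exp (-((1 + η) * lam * r)) with hE
  have hE0 : 0 < E := Real.exp_pos _
  have t1 : W * f ≤ E * Real.exp (-1) := by
    calc W * f ≤ Real.exp (6 * D * r * h) * Real.exp (-ω * h) := by gcongr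
      _ = Real.exp (6 * D * r * h + -ω * h) := (Real.exp_add _ _).symm
      _ ≤ Real.exp (-((1 + η) * lam * r) + -1) := by
        apply Real.exp_le_exp.2
        rw [hω]
        have e2 : 2 * r * lam ≤ 2 * r * D * B / η * h := by
          have := mul_le_mul_of_nonneg_left hl2 (by linarith : 0 ≤ 2 * r)
          refine this.trans (le_of_eq (by ring))
        have e3 : η * (lam * r) ≤ 1 * (lam * r) := by
          apply mul_le_mul_of_nonneg_right (by linarith) (by positivity)
        nlinarith
      _ = _ := Real.exp_add _ _
  have t2 : W * Real.exp (-(2 + ε) * lam * ((1 / 2 - 2 * η) * r)) ≤ E * Real.exp (-1) := by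
    calc _ ≤ Real.exp (6 * D * r * h) * Real.exp (-(2 + ε) * lam * ((1 / 2 - 2 * η) * r)) := by gcongr
      _ = Real.exp (6 * D * r * h + -(2 + ε) * lam * ((1 / 2 - 2 * η) * r)) := (Real.exp_add _ _).symm
      _ ≤ Real.exp (-((1 + η) * lam * r) + -1) := by
        apply Real.exp_le_exp.2
        rw [hε]
        have e1 : (80 * η ^ 2) * (lam * r) ≤ (2 * η) * (lam * r) := by
          apply mul_le_mul_of_nonneg_right _ (by positivity)
          nlinarith
        nlinarith
      _ = _ := Real.exp_add _ _
  rw [mul_add]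
  nlinarith

theorem main (ξ : ℝ) (ε : ℝ) (hε : 0 < ε) (hε1 : ε ≤ 1)
    (p : ℕ → ℤ) (q : ℕ → ℕ) (hq : ∀ n, 2 ≤ q n)
    (hdist : ∀ m n, m ≠ n → (p m : ℝ) / (q m : ℝ) ≠ (p n : ℝ) / (q n : ℝ))
    (happrox : ∀ n, |ξ - (p n : ℝ) / (q n : ℝ)| ≤ (q n : ℝ) ^ (-(2 + ε)))
    (hgrowth : ∃ C : ℝ, ∀ᶠ n in Filter.atTop, Real.log (q (n + 1)) ≤ C * Real.log (q n))
    (m : ℕ) : WFinite ξ m := by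
  have happ1 : ∀ n, |ξ - (p n : ℝ) / (q n : ℝ)| ≤ 1 := fun n =>
    (happrox n).trans (Real.rpow_le_one_of_one_le_of_nonpos
      (by exact_mod_cast (by linarith [hq n] : 1 ≤ q n)) (by linarith))
  obtain ⟨C, L0, hC, hL0, hsup⟩ := supply ξ p q hq hdist happ1 hgrowth
  set η := ε / 40 with hη
  have hη0 : 0 < η := by positivity
  have hη1 : η ≤ 1 / 40 := by rw [hη]; linarith
  set r := ⌈(m : ℝ) / (2 * η ^ 2)⌉₊ + 1 with hr
  have hr1 : 1 ≤ r := by omega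
  have hrm : (m : ℝ) / (2 * η ^ 2) ≤ r := by
    rw [hr]; push_cast
    linarith [Nat.le_ceil ((m : ℝ) / (2 * η ^ 2))]
  obtain ⟨M, ρ, hρ, hgeo⟩ := geo r r le_rfl η hη0
  obtain ⟨D, B, hD, hB, htup⟩ := tuples (fun n => Real.log (q n)) C L0 hC hL0 hsup r η hη0
    (by linarith) M ρ hρ
  set H0 := ⌈512 * (1 + |ξ|) + Real.exp (η * L0) + 3⌉₊ with hH0
  have hr1' : (1 : ℝ) ≤ r := by exact_mod_cast hr1
  set ω := 6 * D * r + 2 * r * D * B / η + 1 with hω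
  have hω0 : 0 < ω := by positivity
  refine ⟨ω, (finite_height m H0).subset ?_⟩
  rintro F ⟨hFm, hF0, hF⟩
  refine ⟨hFm, ?_⟩
  by_contra hcon
  push Not at hcon
  set H := polyHeight F with hHdef
  have hHR : 512 * (1 + |ξ|) + Real.exp (η * L0) + 3 ≤ H :=
    (Nat.le_ceil _).trans (by exact_mod_cast hcon.le)
  have hxi := abs_nonneg ξ
  have hexp := Real.exp_pos (η * L0)
  have hH1 : (1 : ℝ) ≤ H := by linarith
  have hHpos : (0 : ℝ) < H := by linarith
  set h := Real.log H with hh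
  have hh1 : 1 ≤ h := by
    rw [hh, Real.le_log_iff_exp_le hHpos]
    have := Real.exp_one_lt_d9
    linarith
  have hhL : η * L0 ≤ h := by
    rw [hh, Real.le_log_iff_exp_le hHpos]
    linarith
  have hFexp : |aeval ξ F| ≤ Real.exp (-ω * h) := by
    refine hF.trans (le_of_eq ?_)
    rw [Real.rpow_def_of_pos hHpos, mul_comm]
  rcases Nat.eq_zero_or_pos F.natDegree with hdeg | hdeg
  · rw [natDegree_eq_zero] at hdeg
    obtain ⟨a, rfl⟩ := hdeg
    have e1 : aeval ξ (Polynomial.C a : ℤ[X]) = (a : ℝ) := by simp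
    rw [e1] at hF0 hFexp
    have e2 : a ≠ 0 := by rintro rfl; simp at hF0
    have e3 : (1 : ℝ) ≤ |(a : ℝ)| := by exact_mod_cast Int.one_le_abs e2
    have e4 : Real.exp (-ω * h) < 1 := by
      rw [Real.exp_lt_one_iff]; nlinarith
    linarith
  have hΛ : L0 ≤ h / η := by rw [le_div_iff₀ hη0]; linarith
  obtain ⟨d, hd, hsep, hdD, S, hM, nn, lam, hinj, hlam⟩ := htup (h / η) hΛ
  have hgeo' : ∀ d : Fin r → ℕ, (∀ i, 0 < d i) → (∀ i j, i < j → (d j : ℝ) ≤ ρ * d i) →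
      ∀ (S : Finset ℕ) (s : ℕ → Fin r → ℝ), (∀ i, Set.InjOn (fun k => s k i) S) → M ≤ S.card →
      ∀ P : A r, P ≠ 0 → P ∈ Box d → ∃ k ∈ S, ∃ e, (shift (s k) P).coeff e ≠ 0 ∧ wt d e ≤ η := by
    intro d hd hsep S s hs hM P hP hB
    exact hgeo d hd hsep S s hs hM P hP (Box_mono (fun i => by simp) hB)
  obtain ⟨k, hk, hcore⟩ := core F F.natDegree m rfl hdeg hFm H (by exact_mod_cast hH1)
    (coeff_le_height F) ξ hr1 η ε hη0 (by linarith) hε hrm M ρ hgeo' d hd hsep S hM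
    (fun k i => p (nn k i)) (fun k i => q (nn k i))
    (by
      intro i a ha b hb hab
      apply hinj i ha hb
      by_contra hne
      exact hdist _ _ hne hab)
    (fun k i => by linarith [hq (nn k i)]) (fun k i => happrox _) lam
    (fun k hk => ⟨le_trans (by positivity) (hlam k hk).1, (hlam k hk).2.2⟩)
  obtain ⟨hl1, hl2, -⟩ := hlam k hk
  have hK : ((∑ i, d i : ℕ) : ℝ) ≤ 2 * D * r := by
    push_cast
    refine (Finset.sum_le_card_nsmul _ _ _ fun i _ => hdD i).trans (le_of_eq ?_)
    rw [Finset.card_univ, Fintype.card_fin, nsmul_eq_mul]; ring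
  have hW : (512 * (H : ℝ) ^ 2 * (1 + |ξ|)) ^ (∑ i, d i) ≤ Real.exp (6 * D * r * h) := by
    have e1 : 512 * (H : ℝ) ^ 2 * (1 + |ξ|) ≤ Real.exp (3 * h) := by
      have e2 : Real.exp (3 * h) = (H : ℝ) ^ 3 := by
        rw [show (3 : ℝ) * h = ((3 : ℕ) : ℝ) * h by norm_num, Real.exp_nat_mul, hh, Real.exp_log hHpos]
      rw [e2]
      have e3 : 512 * (1 + |ξ|) ≤ H := by linarith
      calc 512 * (H : ℝ) ^ 2 * (1 + |ξ|) = (H : ℝ) ^ 2 * (512 * (1 + |ξ|)) := by ring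
        _ ≤ (H : ℝ) ^ 2 * H := by gcongr
        _ = _ := by ring
    refine (pow_le_pow_left₀ (by positivity) e1 _).trans ?_
    rw [← Real.exp_nat_mul]
    apply Real.exp_le_exp.2
    calc ((∑ i, d i : ℕ) : ℝ) * (3 * h) ≤ (2 * D * r) * (3 * h) := by gcongr
      _ = _ := by ring
  have := final_ineq η ε h D B (lam k) r |aeval ξ F| _ ω hη0 hε1 hη hh1 hD hr1' hl1 hl2 hω
    (abs_nonneg _) hFexp hW (by positivity)
  linarith

end Bak

/-- Baker's criterion: `ξ` is not a `U`-number. -/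
theorem stmt11 (ξ : ℝ) (ε : ℝ) (hε : 0 < ε)
    (p : ℕ → ℤ) (q : ℕ → ℕ) (hq : ∀ n, 2 ≤ q n)
    (hdist : ∀ m n, m ≠ n → (p m : ℝ) / (q m : ℝ) ≠ (p n : ℝ) / (q n : ℝ))
    (happrox : ∀ n, |ξ - (p n : ℝ) / (q n : ℝ)| < (q n : ℝ) ^ (-(2 + ε)))
    (hgrowth : ∃ C : ℝ, ∀ᶠ n in Filter.atTop, Real.log (q (n + 1)) ≤ C * Real.log (q n)) :
    ∀ m : ℕ, 1 ≤ m → WFinite ξ m := by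
  intro m _
  refine Bak.main ξ (min ε 1) (lt_min hε one_pos) (min_le_right _ _) p q hq hdist ?_ hgrowth m
  intro n
  refine (happrox n).le.trans (Real.rpow_le_rpow_of_exponent_le ?_ ?_)
  · exact_mod_cast (by linarith [hq n] : 1 ≤ q n)
  · have := min_le_left ε 1
    linarith
end

section
/- Let ξ be a real number and suppose there exist real numbers η' ≥ η > 1, s > 1, an integer r ≥ 1 and an infinite sequence (α_n)_{n≥1} of algebraic numbers of degree r such that H(α_n) < H(α_{n+1}) < H(α_n)^s and H(α_n)^{−η'} < |ξ − α_n| < H(α_n)^{−η} for all n. Then for every positive integer t < η, ξ is not a U_t-number. -/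
open Polynomial

/-- `Q` is a minimal integer polynomial of `x`; `polyHeight Q` is then the height `H(x)`. -/
def MinIntPoly (x : ℝ) (Q : Polynomial ℤ) : Prop :=
  Q ≠ 0 ∧ aeval x Q = 0 ∧
    (∀ R : Polynomial ℤ, R ≠ 0 → aeval x R = 0 → Q.natDegree ≤ R.natDegree) ∧ Q.content = 1

theorem coeff_le_ht (P : ℤ[X]) (i : ℕ) : |(P.coeff i : ℝ)| ≤ polyHeight P := by
  by_cases h : i ∈ P.support
  · have : (P.coeff i).natAbs ≤ polyHeight P := Finset.le_sup (f := fun i => (P.coeff i).natAbs) h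
    rw [← Int.cast_abs, ← Int.natCast_natAbs]
    exact_mod_cast this
  · rw [notMem_support_iff.mp h]; simp

theorem one_le_ht (P : ℤ[X]) (hP : P ≠ 0) : (1:ℝ) ≤ polyHeight P := by
  have h := coeff_le_ht P P.natDegree
  refine le_trans ?_ h
  have : P.coeff P.natDegree ≠ 0 := by simpa using hP
  exact_mod_cast Int.one_le_abs this

theorem ht_le (P : ℤ[X]) (B : ℝ) (hB : 0 ≤ B) (h : ∀ i, |(P.coeff i : ℝ)| ≤ B) :
    (polyHeight P : ℝ) ≤ B := by
  rw [← Nat.le_floor_iff hB]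
  refine Finset.sup_le fun i _ => ?_
  rw [Nat.le_floor_iff hB]
  have := h i
  rwa [← Int.cast_abs, ← Int.natCast_natAbs, Int.cast_natCast] at this

theorem norm_aeval_le (P : ℤ[X]) (t : ℕ) (ht : P.natDegree ≤ t) (x : ℂ) :
    ‖aeval x P‖ ≤ (t + 1) * polyHeight P * (max 1 ‖x‖) ^ t := by
  rw [Polynomial.aeval_eq_sum_range' (n := t+1) (by omega)]
  refine (norm_sum_le _ _).trans ?_
  have : ∀ i ∈ Finset.range (t+1), ‖P.coeff i • x ^ i‖ ≤ polyHeight P * (max 1 ‖x‖) ^ t := by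
    intro i hi
    rw [zsmul_eq_mul, norm_mul, norm_pow, Complex.norm_intCast]
    gcongr
    · exact coeff_le_ht P i
    · calc ‖x‖ ^ i ≤ (max 1 ‖x‖) ^ i := by gcongr; exact le_max_right _ _
        _ ≤ _ := pow_le_pow_right₀ (le_max_left _ _) (by simp at hi; omega)
  refine (Finset.sum_le_sum this).trans ?_
  simp [mul_assoc]

theorem mahler_le (P : ℤ[X]) (t : ℕ) (ht : P.natDegree ≤ t) :
    (P.map (Int.castRingHom ℂ)).mahlerMeasure ≤ (t + 1) * polyHeight P := by
  refine (mahlerMeasure_le_sum_norm_coeff _).trans ?_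
  rw [Polynomial.sum_over_range' _ (by simp) (t+1) (by
    have := natDegree_map_le (f := Int.castRingHom ℂ) (p := P); omega)]
  have : ∀ i ∈ Finset.range (t+1), ‖(P.map (Int.castRingHom ℂ)).coeff i‖ ≤ (polyHeight P : ℝ) := by
    intro i _
    rw [coeff_map, eq_intCast, Complex.norm_intCast]
    exact coeff_le_ht P i
  refine (Finset.sum_le_sum this).trans ?_
  simp

theorem lip (P : ℤ[X]) (t : ℕ) (ht : P.natDegree ≤ t) (x y B : ℝ) (hB : 1 ≤ B)
    (hx : |x| ≤ B) (hy : |y| ≤ B) :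
    |aeval x P - aeval y P| ≤ ((t + 1) * t * B ^ t) * polyHeight P * |x - y| := by
  rw [Polynomial.aeval_eq_sum_range' (n := t+1) (by omega),
    Polynomial.aeval_eq_sum_range' (n := t+1) (by omega), ← Finset.sum_sub_distrib]
  refine (Finset.abs_sum_le_sum_abs _ _).trans ?_
  have : ∀ i ∈ Finset.range (t+1), |P.coeff i • x ^ i - P.coeff i • y ^ i| ≤
      polyHeight P * (|x - y| * t * B ^ t) := by
    intro i hi
    have hi : i ≤ t := by simp at hi; omega
    rw [zsmul_eq_mul, zsmul_eq_mul, ← mul_sub, abs_mul]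
    gcongr
    · exact coeff_le_ht P i
    · refine (abs_pow_sub_pow_le x y i).trans ?_
      gcongr
      calc _ ≤ B ^ (i-1) := by gcongr; exact max_le hx hy
        _ ≤ _ := pow_le_pow_right₀ hB (by omega)
  refine (Finset.sum_le_sum this).trans (le_of_eq ?_)
  simp; ring

theorem map_dvd_of_root (x : ℝ) (Q : ℤ[X]) (hQ : MinIntPoly x Q) :
    Associated (Q.map (Int.castRingHom ℚ)) (minpoly ℚ x) := by
  obtain ⟨h0, hr, hm, -⟩ := hQ
  have hinj : Function.Injective (Int.castRingHom ℚ) := Int.cast_injective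
  have hQ0 : Q.map (Int.castRingHom ℚ) ≠ 0 := (Polynomial.map_ne_zero_iff hinj).2 h0
  have hroot : aeval x (Q.map (Int.castRingHom ℚ)) = 0 := by
    rw [← hr]; exact aeval_map_algebraMap ℚ x Q
  have hd := minpoly.dvd ℚ x hroot
  have hint : IsIntegral ℚ x := isAlgebraic_iff_isIntegral.mp ⟨_, hQ0, hroot⟩
  refine (associated_of_dvd_of_natDegree_le hd hQ0 ?_).symm
  rw [natDegree_map_eq_of_injective hinj]
  obtain ⟨b, hbm, hb⟩ := IsLocalization.integerNormalization_spec (nonZeroDivisors ℤ) (minpoly ℚ x)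
  set R := IsLocalization.integerNormalization (nonZeroDivisors ℤ) (minpoly ℚ x)
  have hb0 : (b : ℤ) ≠ 0 := nonZeroDivisors.ne_zero hbm
  have hbQ : ((b : ℤ) : ℚ) ≠ 0 := by exact_mod_cast hb0
  have hb' : R.map (algebraMap ℤ ℚ) = C ((b : ℤ) : ℚ) * minpoly ℚ x := by
    rw [hb, ← smul_eq_C_mul]; ext; simp
  have hR0 : R ≠ 0 := by
    intro h
    rw [h, Polynomial.map_zero] at hb'
    exact mul_ne_zero (C_ne_zero.2 hbQ) (minpoly.ne_zero hint) hb'.symm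
  have hRx : aeval x R = 0 := by
    rw [← aeval_map_algebraMap ℚ, hb']; simp
  refine (hm R hR0 hRx).trans ?_
  rw [← natDegree_map_eq_of_injective (f := algebraMap ℤ ℚ) hinj, hb', natDegree_C_mul hbQ]

theorem root_ht (x : ℝ) (Q P : ℤ[X]) (hQ : MinIntPoly x Q) (r t : ℕ) (hr : Q.natDegree = r)
    (ht : P.natDegree ≤ t) (hP : P ≠ 0) (hx : aeval x P = 0) :
    (polyHeight Q : ℝ) ≤ 2 ^ r * ((t + 1) * polyHeight P) := by
  have h1 : Q.map (Int.castRingHom ℚ) ∣ P.map (Int.castRingHom ℚ) := by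
    rw [(map_dvd_of_root x Q hQ).dvd_iff_dvd_left]
    refine minpoly.dvd ℚ x ?_
    rw [← hx]; exact aeval_map_algebraMap ℚ x P
  have hprim : Q.IsPrimitive := isPrimitive_iff_content_eq_one.2 hQ.2.2.2
  have h2 : Q ∣ P := by
    have h3 : Q.map (Int.castRingHom ℚ) ∣ P.primPart.map (Int.castRingHom ℚ) := by
      rw [P.eq_C_content_mul_primPart, Polynomial.map_mul, map_C] at h1
      refine (IsUnit.dvd_mul_left ?_).1 h1
      rw [isUnit_C, isUnit_iff_ne_zero]
      simpa [content_eq_zero_iff] using hP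
    have h4 := (IsPrimitive.Int.dvd_iff_map_cast_dvd_map_cast Q P.primPart hprim).2 h3
    exact h4.trans P.primPart_dvd
  obtain ⟨R, rfl⟩ := h2
  have hR : R ≠ 0 := right_ne_zero_of_mul hP
  refine ht_le _ _ (by positivity) fun i => ?_
  have h5 := norm_coeff_le_choose_mul_mahlerMeasure_of_one_le_mahlerMeasure i
    (Q.map (Int.castRingHom ℂ)) _ (one_le_mahlerMeasure_of_ne_zero hR)
  rw [← Polynomial.map_mul, coeff_map, eq_intCast, Complex.norm_intCast,
    natDegree_map_eq_of_injective (RingHom.injective_int _), hr] at h5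
  refine h5.trans ?_
  gcongr
  · exact mahlerMeasure_nonneg _
  · exact_mod_cast Nat.choose_le_two_pow r i
  · exact mahler_le _ _ ht

theorem liou (x : ℝ) (Q P : ℤ[X]) (hQ : MinIntPoly x Q) (r t : ℕ) (hr : Q.natDegree = r)
    (hr1 : 1 ≤ r) (ht : P.natDegree ≤ t) (hx : aeval x P ≠ 0) :
    1 ≤ |aeval x P| * ((t + 1) * polyHeight P) ^ (r - 1) * ((r + 1) * polyHeight Q : ℝ) ^ t := by
  have hA := map_dvd_of_root x Q hQ
  have hQ0 := hQ.1
  have hinj : Function.Injective (Int.castRingHom ℚ) := Int.cast_injective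
  have hinjC : Function.Injective (Int.castRingHom ℂ) := Int.cast_injective
  have hQ0' : Q.map (Int.castRingHom ℚ) ≠ 0 := (Polynomial.map_ne_zero_iff hinj).2 hQ0
  have hroot : aeval x (Q.map (Int.castRingHom ℚ)) = 0 := by
    rw [← hQ.2.1]; exact aeval_map_algebraMap ℚ x Q
  have hint : IsIntegral ℚ x := isAlgebraic_iff_isIntegral.mp ⟨_, hQ0', hroot⟩
  have hirr : Irreducible (Q.map (Int.castRingHom ℚ)) := hA.irreducible_iff.2 (minpoly.irreducible hint)
  have hcop : IsCoprime (Q.map (Int.castRingHom ℚ)) (P.map (Int.castRingHom ℚ)) := by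
    rw [hirr.coprime_iff_not_dvd]
    rintro ⟨S, hS⟩
    apply hx
    have : aeval x (P.map (Int.castRingHom ℚ)) = aeval x P := aeval_map_algebraMap ℚ x P
    rw [← this, hS, map_mul, hroot, zero_mul]
  have hres : Q.resultant P r t ≠ 0 := by
    have h1 := resultant_ne_zero _ _ hcop
    rw [natDegree_map_eq_of_injective hinj, natDegree_map_eq_of_injective hinj,
      resultant_map_map] at h1
    obtain ⟨k, rfl⟩ := Nat.exists_eq_add_of_le ht
    rw [resultant_add_right_deg _ _ _ _ _ le_rfl, ← hr]
    refine mul_ne_zero (pow_ne_zero _ (by simpa using hQ0)) ?_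
    intro h; rw [h] at h1; simp at h1
  set q := Q.map (Int.castRingHom ℂ) with hq
  have hq0 : q ≠ 0 := (Polynomial.map_ne_zero_iff hinjC).2 hQ0
  have hqd : q.natDegree = r := by rw [hq, natDegree_map_eq_of_injective hinjC, hr]
  have hprod := resultant_eq_prod_eval q (P.map (Int.castRingHom ℂ)) t
    (natDegree_map_le.trans ht) (IsAlgClosed.splits q)
  rw [hqd, hq, resultant_map_map, ← hq] at hprod
  have hmem : (x : ℂ) ∈ q.roots := by
    rw [mem_roots hq0, IsRoot.def, hq, eval_map, ← algebraMap_int_eq, ← aeval_def]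
    have := aeval_algebraMap_apply ℂ x Q
    rw [hQ.2.1] at this; simpa using this
  obtain ⟨ρ, hρ⟩ := Multiset.exists_cons_of_mem hmem
  have hcard : Multiset.card ρ = r - 1 := by
    have := splits_iff_card_roots.mp (IsAlgClosed.splits q)
    rw [hρ, hqd, Multiset.card_cons] at this; omega
  have hev : ∀ z : ℂ, eval z (P.map (Int.castRingHom ℂ)) = aeval z P := by
    intro z; rw [eval_map, ← algebraMap_int_eq, ← aeval_def]
  have hone : (1:ℝ) ≤ ‖((Q.resultant P r t : ℤ) : ℂ)‖ := by
    rw [Complex.norm_intCast]; exact_mod_cast Int.one_le_abs hres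
  rw [eq_intCast] at hprod
  rw [hprod, hρ, Multiset.map_cons, Multiset.prod_cons, norm_mul, norm_mul, norm_pow, hev] at hone
  have hxx : ‖aeval (x:ℂ) P‖ = |aeval x P| := by
    have := aeval_algebraMap_apply ℂ x P
    simp at this; rw [this]; simp
  rw [hxx] at hone
  have hrest : ‖(ρ.map fun z => eval z (P.map (Int.castRingHom ℂ))).prod‖ ≤
      ((t + 1) * polyHeight P) ^ (r - 1) * ((ρ.map fun a => max 1 ‖a‖).prod) ^ t := by
    rw [← hcard]
    clear hρ hcard hone
    induction ρ using Multiset.induction_on with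
    | empty => simp
    | cons a s ih =>
      simp only [Multiset.map_cons, Multiset.prod_cons, norm_mul, Multiset.card_cons, hev] at ih ⊢
      calc _ ≤ ((t + 1) * polyHeight P * (max 1 ‖a‖) ^ t) * _ :=
            mul_le_mul (norm_aeval_le P t ht a) ih (norm_nonneg _) (by positivity)
        _ = _ := by ring
  have hM : ‖q.leadingCoeff‖ * (ρ.map fun a => max 1 ‖a‖).prod ≤ (r + 1) * polyHeight Q := by
    refine le_trans ?_ (mahler_le Q r hr.le)
    rw [← hq, mahlerMeasure_eq_leadingCoeff_mul_prod_roots, hρ, Multiset.map_cons, Multiset.prod_cons]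
    gcongr
    refine le_mul_of_one_le_left ?_ (le_max_left _ _)
    exact Multiset.prod_nonneg (by simp)
  have hnn : 0 ≤ (ρ.map fun a => max 1 ‖a‖).prod :=
    Multiset.prod_nonneg (by simp)
  calc (1:ℝ) ≤ _ := hone
    _ ≤ ‖q.leadingCoeff‖ ^ t * (|aeval x P| * (((t + 1) * polyHeight P) ^ (r - 1) * ((ρ.map fun a => max 1 ‖a‖).prod) ^ t)) := by gcongr
    _ = |aeval x P| * ((t + 1) * polyHeight P) ^ (r - 1) * (‖q.leadingCoeff‖ * (ρ.map fun a => max 1 ‖a‖).prod) ^ t := by ring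
    _ ≤ _ := by gcongr

theorem ht_finite (t : ℕ) (B : ℝ) :
    {P : ℤ[X] | P.natDegree ≤ t ∧ (polyHeight P : ℝ) ≤ B}.Finite := by
  refine (finite_mahlerMeasure_le t (Real.toNNReal ((t + 1) * B))).subset ?_
  rintro P ⟨h1, h2⟩
  refine ⟨h1, (mahler_le P t h1).trans (le_trans ?_ (Real.le_coe_toNNReal _))⟩
  gcongr

set_option maxHeartbeats 1000000 in
theorem main_fin (ξ : ℝ) (η η' s : ℝ) (hη : 1 < η) (hs : 1 < s)
    (r : ℕ) (hr : 1 ≤ r)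
    (α : ℕ → ℝ) (Pm : ℕ → Polynomial ℤ)
    (hmin : ∀ n, MinIntPoly (α n) (Pm n)) (hdeg : ∀ n, (Pm n).natDegree = r)
    (hH1 : ∀ n, polyHeight (Pm n) < polyHeight (Pm (n + 1)))
    (hH2 : ∀ n, (polyHeight (Pm (n + 1)) : ℝ) < (polyHeight (Pm n) : ℝ) ^ s)
    (happ : ∀ n, (polyHeight (Pm n) : ℝ) ^ (-η') < |ξ - α n| ∧
      |ξ - α n| < (polyHeight (Pm n) : ℝ) ^ (-η)) (t : ℕ) (ht : (t : ℝ) < η) : WFinite ξ t := by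
  set δ := η - t with hδ
  have hδ0 : 0 < δ := sub_pos.2 ht
  set K : ℝ := (t + 1) ^ (r - 1) * (r + 1) ^ t with hK
  have hK0 : 0 < K := by positivity
  set C : ℝ := (t + 1) * t * (|ξ| + 1) ^ t with hC
  have hC0 : 0 ≤ C := by positivity
  set a : ℝ := r / δ + 1 with ha
  have ha1 : 1 ≤ a := by rw [ha]; have : 0 ≤ r / δ := by positivity
                         linarith
  set A : ℝ := (2 * K * C + 1) ^ (1 / δ) + 2 ^ r * (t + 1) + 1 with hA
  have hA1 : 1 ≤ A := by
    have : 0 ≤ (2 * K * C + 1) ^ (1 / δ) + 2 ^ r * (t + 1) := by positivity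
    linarith
  have hh1 : ∀ n, (1:ℝ) ≤ polyHeight (Pm n) := fun n => one_le_ht _ (hmin n).1
  set D : ℝ := polyHeight (Pm 0) * A ^ s with hD
  have hD0 : 0 < D := mul_pos (lt_of_lt_of_le one_pos (hh1 0)) (by positivity)
  refine ⟨r + a * s * t, (ht_finite t (2 * K * D ^ t)).subset ?_⟩
  rintro P ⟨hPd, hP0, hPs⟩
  refine ⟨hPd, ?_⟩
  by_contra! hbig
  have hPne : P ≠ 0 := by rintro rfl; simp at hP0
  have hX1 := one_le_ht P hPne
  set X : ℝ := (polyHeight P : ℝ) with hX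
  have hX0 : 0 < X := by linarith
  -- choose `n`
  have hgrow : ∀ n, n ≤ polyHeight (Pm n) := by
    intro n
    induction n with
    | zero => simp
    | succ n ih => have := hH1 n; omega
  have hex : ∃ n, A * X ^ a ≤ polyHeight (Pm n) := by
    obtain ⟨n, hn⟩ := exists_nat_ge (A * X ^ a)
    exact ⟨n, hn.trans (by exact_mod_cast hgrow n)⟩
  obtain ⟨n, hn1, hn2⟩ : ∃ n, A * X ^ a ≤ polyHeight (Pm n) ∧
      (polyHeight (Pm n) : ℝ) ≤ D * X ^ (a * s) := by
    classical
    refine ⟨Nat.find hex, Nat.find_spec hex, ?_⟩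
    have hXas : 1 ≤ X ^ (a * s) := Real.one_le_rpow hX1 (by positivity)
    have hAs : 1 ≤ A ^ s := Real.one_le_rpow hA1 (by positivity)
    rcases hfind : Nat.find hex with _ | m
    · rw [hD, mul_assoc]
      refine le_mul_of_one_le_right (by positivity) ?_
      nlinarith
    · have hm := Nat.find_min hex (m := m) (by omega)
      push Not at hm
      refine (hH2 m).le.trans ?_
      calc (polyHeight (Pm m) : ℝ) ^ s ≤ (A * X ^ a) ^ s := by gcongr
        _ = A ^ s * X ^ (a * s) := by
            rw [Real.mul_rpow (by positivity) (by positivity), ← Real.rpow_mul hX0.le]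
        _ ≤ _ := by
            gcongr
            exact le_mul_of_one_le_left (by positivity) (hh1 0)
  set h : ℝ := (polyHeight (Pm n) : ℝ) with hh
  have hh0 : 1 ≤ h := hh1 n
  have hhpos : 0 < h := by linarith
  -- nonvanishing
  have hne : aeval (α n) P ≠ 0 := by
    intro h0
    have h1 := root_ht (α n) (Pm n) P (hmin n) r t (hdeg n) hPd hPne h0
    rw [← hX, ← hh] at h1
    have h2 : X ≤ X ^ a := by simpa using Real.rpow_le_rpow_of_exponent_le hX1 ha1
    have h3 : (2 ^ r * (t + 1) + 1) * X ≤ A * X ^ a := by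
      gcongr
      rw [hA]
      have : 0 ≤ (2 * K * C + 1) ^ (1 / δ) := by positivity
      linarith
    nlinarith
  have hL := liou (α n) (Pm n) P (hmin n) r t (hdeg n) hr hPd hne
  rw [← hX, ← hh] at hL
  have hclose : |ξ - α n| ≤ 1 :=
    (happ n).2.le.trans (Real.rpow_le_one_of_one_le_of_nonpos hh0 (by linarith))
  have hαB : |α n| ≤ |ξ| + 1 := by
    have := abs_sub_abs_le_abs_sub (α n) ξ
    rw [abs_sub_comm] at this; linarith
  have hlip := lip P t hPd ξ (α n) (|ξ| + 1) (by linarith [abs_nonneg ξ]) (by linarith) hαB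
  rw [← hC, ← hX] at hlip
  have hval : |aeval (α n) P| ≤ X ^ (-(r + a * s * t)) + C * X * h ^ (-η) := by
    have h1 : |aeval (α n) P| ≤ |aeval ξ P| + |aeval ξ P - aeval (α n) P| := by
      have := abs_sub_abs_le_abs_sub (aeval (α n) P) (aeval ξ P)
      rw [abs_sub_comm (aeval (α n) P)] at this; linarith
    have h2 : C * X * |ξ - α n| ≤ C * X * h ^ (-η) := by gcongr; exact (happ n).2.le
    linarith
  have hfin : 1 ≤ (X ^ (-(r + a * s * t)) + C * X * h ^ (-η)) * (K * X ^ (r - 1) * h ^ t) := by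
    refine hL.trans ?_
    rw [mul_pow, mul_pow, mul_assoc]
    rw [show ((t:ℝ) + 1) ^ (r - 1) * X ^ (r - 1) * ((r + 1) ^ t * h ^ t) =
      K * X ^ (r - 1) * h ^ t by rw [hK]; ring]
    gcongr
  have hXr : X ^ (r - 1) * X = X ^ r := by rw [← pow_succ]; congr 1; omega
  -- first term
  have hT1 : X ^ (-(r + a * s * t)) * (K * X ^ (r - 1) * h ^ t) < 1 / 2 := by
    have e1 : h ^ t ≤ D ^ t * X ^ (a * s * t) := by
      calc h ^ t ≤ (D * X ^ (a * s)) ^ t := by gcongr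
        _ = _ := by rw [mul_pow, ← Real.rpow_mul_natCast hX0.le]
    have e2 : X ^ (-(r + a * s * t)) * X ^ r * X ^ (a * s * t) = 1 := by
      rw [← Real.rpow_natCast X r, ← Real.rpow_add hX0, ← Real.rpow_add hX0]
      ring_nf; simp
    have e3 : X ^ (-(r + a * s * t)) * (K * X ^ (r - 1) * h ^ t) * X ≤ K * D ^ t := by
      calc _ ≤ X ^ (-(r + a * s * t)) * (K * X ^ (r - 1) * (D ^ t * X ^ (a * s * t))) * X := by
            gcongr
        _ = K * D ^ t * (X ^ (-(r + a * s * t)) * (X ^ (r - 1) * X) * X ^ (a * s * t)) := by ring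
        _ = K * D ^ t := by rw [hXr, e2, mul_one]
    by_contra! hc
    have e4 := mul_le_mul_of_nonneg_right hc hX0.le
    linarith
  have hT2 : C * X * h ^ (-η) * (K * X ^ (r - 1) * h ^ t) ≤ 1 / 2 := by
    have e1 : h ^ (-η) * h ^ t * h ^ δ = 1 := by
      rw [← Real.rpow_natCast h t, ← Real.rpow_add hhpos, ← Real.rpow_add hhpos, hδ]
      ring_nf; simp
    have e2 : (2 * K * C + 1) * X ^ r ≤ h ^ δ := by
      calc (2 * K * C + 1) * X ^ r ≤ A ^ δ * X ^ (a * δ) := by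
            gcongr
            · calc 2 * K * C + 1 = ((2 * K * C + 1) ^ (1 / δ)) ^ δ := by
                    rw [← Real.rpow_mul (by positivity), one_div, inv_mul_cancel₀ hδ0.ne',
                      Real.rpow_one]
                _ ≤ A ^ δ := by
                    gcongr
                    rw [hA]
                    have : (0:ℝ) ≤ 2 ^ r * (t + 1) := by positivity
                    linarith
            · rw [← Real.rpow_natCast X r]
              apply Real.rpow_le_rpow_of_exponent_le hX1
              rw [ha, add_mul, div_mul_cancel₀ _ hδ0.ne']
              linarith
        _ = (A * X ^ a) ^ δ := by
            rw [Real.mul_rpow (by positivity) (by positivity), ← Real.rpow_mul hX0.le]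
        _ ≤ h ^ δ := by gcongr
    have e3 : C * X * h ^ (-η) * (K * X ^ (r - 1) * h ^ t) =
        K * C * X ^ r * (h ^ (-η) * h ^ t) := by rw [← hXr]; ring
    rw [e3]
    have e4 : 0 < h ^ (-η) * h ^ t := by positivity
    have e5 : 2 * K * C * X ^ r ≤ h ^ δ := by
      have : 0 < X ^ r := by positivity
      linarith
    have e6 := mul_le_mul_of_nonneg_left e5 e4.le
    rw [e1] at e6
    linarith
  rw [add_mul] at hfin
  linarith

theorem stmt19 (ξ : ℝ) (η η' s : ℝ) (hη : 1 < η) (hηη' : η ≤ η') (hs : 1 < s)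
    (r : ℕ) (hr : 1 ≤ r)
    (α : ℕ → ℝ) (Pm : ℕ → Polynomial ℤ)
    -- each `α n` is an algebraic number of degree `r`, with minimal polynomial `Pm n`
    (hmin : ∀ n, MinIntPoly (α n) (Pm n)) (hdeg : ∀ n, (Pm n).natDegree = r)
    -- `H(α_n) < H(α_{n+1}) < H(α_n)^s`
    (hH1 : ∀ n, polyHeight (Pm n) < polyHeight (Pm (n + 1)))
    (hH2 : ∀ n, (polyHeight (Pm (n + 1)) : ℝ) < (polyHeight (Pm n) : ℝ) ^ s)
    -- `H(α_n)^{-η'} < |ξ - α_n| < H(α_n)^{-η}`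
    (happ : ∀ n, (polyHeight (Pm n) : ℝ) ^ (-η') < |ξ - α n| ∧
      |ξ - α n| < (polyHeight (Pm n) : ℝ) ^ (-η)) :
    -- `ξ` is not a `U_t`-number for any positive integer `t < η`
    ∀ t : ℕ, 0 < t → (t : ℝ) < η →
      ¬ (¬ WFinite ξ t ∧ ∀ m, 0 < m → m < t → WFinite ξ m) := by
  rintro t - ht ⟨hnot, -⟩
  exact hnot (main_fin ξ η η' s hη hs r hr α Pm hmin hdeg hH1 hH2 happ t ht)
end
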